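/- Let G be a 2P₇-free graph on n vertices with 14 ≤ n ≤ 21 and with e(G) = [n,14,7]. If G is disconnected, then G is isomorphic to K₁₃ ∪ H, where H is a P₇-free graph on n − 13 vertices with the maximum number ex(n−13, P₇) of edges. -/

import Mathlib

open SimpleGraph

/-- `H` is contained in `G` as a subgraph, i.e. there is an injective graph
homomorphism from `H` to `G` (a copy of `H` in `G`). -/
def Contains {α β : Type*} (H : SimpleGraph α) (G : SimpleGraph β) : Prop :=
  ∃ f : H →g G, Function.Injective f

/-- `2P₇`: the disjoint union of two copies of the path on 7 vertices. -/
def TwoP7 : SimpleGraph (Fin 7 ⊕ Fin 7) :=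
  SimpleGraph.pathGraph 7 ⊕g SimpleGraph.pathGraph 7

/-- The quantity `[n, m, ℓ]` of the paper: writing `n = (m-1) + t(ℓ-1) + r` with
`t ≥ 0`, `0 ≤ r < ℓ-1`, it equals `C(m-1,2) + t·C(ℓ-1,2) + C(r,2)`;
if `n ≤ m-1` it equals `C(n,2)`. -/
def bracket (n m ℓ : ℕ) : ℕ :=
  if n ≤ m - 1 then n.choose 2
  else (m - 1).choose 2 + ((n - (m - 1)) / (ℓ - 1)) * (ℓ - 1).choose 2
    + ((n - (m - 1)) % (ℓ - 1)).choose 2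

section PathLists

open scoped Classical

variable {V : Type*}

/-- A path in `G`, given as the list of its vertices. -/
def IsPathList (G : SimpleGraph V) (l : List V) : Prop :=
  l.IsChain G.Adj ∧ l.Nodup

/-- `G` contains a path on `n` vertices. -/
def HasPath (G : SimpleGraph V) (n : ℕ) : Prop :=
  ∃ l, IsPathList G l ∧ n ≤ l.length

/-- `G` contains two vertex-disjoint paths on (at least) seven vertices each. -/
def HasTwoPaths (G : SimpleGraph V) : Prop :=
  ∃ l₁ l₂ : List V, l₁.IsChain G.Adj ∧ l₂.IsChain G.Adj ∧ (l₁ ++ l₂).Nodup ∧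
    7 ≤ l₁.length ∧ 7 ≤ l₂.length

/-- The only sets of vertices closed under adjacency are the trivial ones. -/
def CutConnected (G : SimpleGraph V) : Prop :=
  ∀ S : Set V, (∀ a ∈ S, ∀ b, G.Adj a b → b ∈ S) → S = ∅ ∨ S = Set.univ

theorem SimpleGraph.isChain_reverse {G : SimpleGraph V} {l : List V} (h : l.IsChain G.Adj) :
    l.reverse.IsChain G.Adj :=
  List.isChain_reverse.2 (h.imp fun _ _ hab => hab.symm)

theorem exists_hom_pathGraph_of_isPathList {G : SimpleGraph V} {l : List V} {n : ℕ}
    (h : l.IsChain G.Adj) (hnd : l.Nodup) (hn : n ≤ l.length) :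
    ∃ f : SimpleGraph.pathGraph n →g G, Function.Injective f ∧ ∀ i, f i ∈ l := by
  refine ⟨⟨fun i => l[i.1]'(by omega), ?_⟩, ?_, ?_⟩
  · intro a b hab
    rw [SimpleGraph.pathGraph_adj] at hab
    rcases hab with hab | hab
    · have := List.isChain_iff_getElem.1 h a.1 (by omega)
      simpa [hab] using this
    · have := List.isChain_iff_getElem.1 h b.1 (by omega)
      simpa [hab] using this.symm
  · intro a b hab
    exact Fin.ext ((hnd.getElem_inj_iff).1 hab)
  · intro i
    exact List.getElem_mem _

theorem HasPath.contains {G : SimpleGraph V} {n : ℕ} (h : HasPath G n) :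
    Contains (SimpleGraph.pathGraph n) G := by
  obtain ⟨l, hl, hn⟩ := h
  obtain ⟨f, hf, -⟩ := exists_hom_pathGraph_of_isPathList hl.1 hl.2 hn
  exact ⟨f, hf⟩

theorem Contains.hasPath {G : SimpleGraph V} {n : ℕ}
    (h : Contains (SimpleGraph.pathGraph n) G) : HasPath G n := by
  obtain ⟨f, hf⟩ := h
  refine ⟨List.ofFn f, ⟨?_, List.nodup_ofFn.2 hf⟩, by simp⟩
  rw [List.isChain_ofFn]
  intro i hi
  exact f.map_adj (by simp [SimpleGraph.pathGraph_adj])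

theorem HasTwoPaths.contains {G : SimpleGraph V} (h : HasTwoPaths G) : Contains TwoP7 G := by
  obtain ⟨l₁, l₂, h₁, h₂, hnd, hl₁, hl₂⟩ := h
  rw [List.nodup_append'] at hnd
  obtain ⟨f, hf, hfm⟩ := exists_hom_pathGraph_of_isPathList h₁ hnd.1 hl₁
  obtain ⟨g, hg, hgm⟩ := exists_hom_pathGraph_of_isPathList h₂ hnd.2.1 hl₂
  refine ⟨⟨Sum.elim f g, ?_⟩, ?_⟩
  · rintro (a | a) (b | b) hab
    · exact f.map_adj (by simpa [TwoP7] using hab)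
    · simp [TwoP7] at hab
    · simp [TwoP7] at hab
    · exact g.map_adj (by simpa [TwoP7] using hab)
  · refine Function.Injective.sumElim hf hg ?_
    intro a b hab
    exact hnd.2.2 (hfm a) (hab ▸ hgm b)

theorem HasPath.hasTwoPaths {G : SimpleGraph V} (h : HasPath G 14) : HasTwoPaths G := by
  obtain ⟨l, ⟨hc, hnd⟩, hl⟩ := h
  refine ⟨l.take 7, l.drop 7, hc.take 7, hc.drop 7, by simpa using hnd, ?_, ?_⟩ <;>
    simp <;> omega

theorem IsPathList.map_val {G : SimpleGraph V} {s : Set V} {l : List s}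
    (h : IsPathList (G.induce s) l) : IsPathList G (l.map Subtype.val) := by
  refine ⟨?_, h.2.map Subtype.val_injective⟩
  rw [List.isChain_map]
  exact h.1.imp fun _ _ hab => hab

theorem HasPath.of_induce {G : SimpleGraph V} {s : Set V} {n : ℕ}
    (h : HasPath (G.induce s) n) : HasPath G n := by
  obtain ⟨l, hl, hn⟩ := h
  exact ⟨_, hl.map_val, by simpa using hn⟩

theorem HasTwoPaths.of_induce {G : SimpleGraph V} {s : Set V}
    (h : HasTwoPaths (G.induce s)) : HasTwoPaths G := by
  obtain ⟨l₁, l₂, h₁, h₂, hnd, hl₁, hl₂⟩ := h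
  refine ⟨l₁.map Subtype.val, l₂.map Subtype.val, ?_, ?_, ?_, by simpa, by simpa⟩
  · rw [List.isChain_map]; exact h₁.imp fun _ _ hab => hab
  · rw [List.isChain_map]; exact h₂.imp fun _ _ hab => hab
  · rw [← List.map_append]; exact hnd.map Subtype.val_injective

theorem hasTwoPaths_of_induce_compl {G : SimpleGraph V} {s : Set V}
    (h₁ : HasPath (G.induce s) 7) (h₂ : HasPath (G.induce sᶜ) 7) : HasTwoPaths G := by
  obtain ⟨l₁, hl₁, hn₁⟩ := h₁
  obtain ⟨l₂, hl₂, hn₂⟩ := h₂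
  refine ⟨_, _, hl₁.map_val.1, hl₂.map_val.1, ?_, by simpa, by simpa⟩
  rw [List.nodup_append']
  refine ⟨hl₁.map_val.2, hl₂.map_val.2, ?_⟩
  intro x hx hx'
  obtain ⟨y, -, rfl⟩ := List.mem_map.1 hx
  obtain ⟨z, -, hz⟩ := List.mem_map.1 hx'
  exact z.2 (hz ▸ y.2)

theorem exists_closed_of_not_connected {G : SimpleGraph V} [Nonempty V] (h : ¬ G.Connected) :
    ¬ CutConnected G := by
  intro hc
  apply h
  rw [SimpleGraph.connected_iff]
  refine ⟨fun u v => ?_, inferInstance⟩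
  rcases hc {w | G.Reachable u w} (fun a ha b hab => ha.trans hab.reachable) with h0 | h1
  · exact absurd (SimpleGraph.Reachable.refl (G := G) u)
      (fun hu => (Set.eq_empty_iff_forall_notMem.1 h0 u) hu)
  · exact (Set.eq_univ_iff_forall.1 h1) v

end PathLists

section EdgeCounts

open scoped Classical

variable {V : Type*}

theorem ncard_edgeSet_induce_le_choose (G : SimpleGraph V) (W : Finset V) :
    (G.induce (W : Set V)).edgeSet.ncard ≤ W.card.choose 2 := by
  rw [← SimpleGraph.coe_edgeFinset, Set.ncard_coe_finset]
  simpa using (G.induce (W : Set V)).card_edgeFinset_le_card_choose_two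

variable [Fintype V]

theorem sum_degree_eq_two_mul_ncard (G : SimpleGraph V) :
    ∑ v, G.degree v = 2 * G.edgeSet.ncard := by
  rw [G.sum_degrees_eq_twice_card_edges, ← SimpleGraph.coe_edgeFinset, Set.ncard_coe_finset]

theorem ncard_edgeSet_le_choose (G : SimpleGraph V) :
    G.edgeSet.ncard ≤ (Fintype.card V).choose 2 := by
  rw [← SimpleGraph.coe_edgeFinset, Set.ncard_coe_finset]
  exact G.card_edgeFinset_le_card_choose_two

theorem ncard_edgeSet_le_induce_add_sum_degree (G : SimpleGraph V) (W : Finset V) :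
    G.edgeSet.ncard ≤ (G.induce (W : Set V)).edgeSet.ncard + ∑ w ∈ Wᶜ, G.degree w := by
  have hsub : G.edgeSet ⊆ (Sym2.map Subtype.val '' (G.induce (W : Set V)).edgeSet) ∪
      ((Wᶜ.biUnion fun w => G.incidenceFinset w : Finset (Sym2 V)) : Set (Sym2 V)) := by
    intro e he
    induction e with
    | _ a b =>
      by_cases ha : a ∈ W
      · by_cases hb : b ∈ W
        · left
          exact ⟨s(⟨a, ha⟩, ⟨b, hb⟩), by simpa using he, by simp⟩
        · right
          simp only [Finset.coe_biUnion, Set.mem_iUnion]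
          exact ⟨b, by simpa using hb, by
            simpa [SimpleGraph.mk'_mem_incidenceSet_iff] using he⟩
      · right
        simp only [Finset.coe_biUnion, Set.mem_iUnion]
        exact ⟨a, by simpa using ha, by
          simpa [SimpleGraph.mk'_mem_incidenceSet_iff] using he⟩
  refine (Set.ncard_le_ncard hsub (Set.toFinite _)).trans ((Set.ncard_union_le _ _).trans ?_)
  gcongr
  · exact Set.ncard_image_le (Set.toFinite _)
  · rw [Set.ncard_coe_finset]
    refine Finset.card_biUnion_le.trans (le_of_eq ?_)
    exact Finset.sum_congr rfl fun w _ => G.card_incidenceFinset_eq_degree w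

theorem ncard_edgeSet_le_induce_add_induce_compl (G : SimpleGraph V) (S : Set V)
    (hS : ∀ a ∈ S, ∀ b, G.Adj a b → b ∈ S) :
    G.edgeSet.ncard ≤ (G.induce S).edgeSet.ncard + (G.induce Sᶜ).edgeSet.ncard := by
  have hsub : G.edgeSet ⊆ (Sym2.map Subtype.val '' (G.induce S).edgeSet) ∪
      (Sym2.map Subtype.val '' (G.induce Sᶜ).edgeSet) := by
    intro e he
    induction e with
    | _ a b =>
      rw [SimpleGraph.mem_edgeSet] at he
      by_cases ha : a ∈ S
      · left
        exact ⟨s(⟨a, ha⟩, ⟨b, hS a ha b he⟩), by simpa using he, by simp⟩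
      · right
        exact ⟨s(⟨a, ha⟩, ⟨b, fun hb => ha (hS b hb a he.symm)⟩), by simpa using he, by simp⟩
  refine (Set.ncard_le_ncard hsub (Set.toFinite _)).trans ((Set.ncard_union_le _ _).trans ?_)
  gcongr <;> exact Set.ncard_image_le (Set.toFinite _)

theorem degree_induce_le (G : SimpleGraph V) (s : Set V) [Fintype s] (v : s) :
    (G.induce s).degree v ≤ G.degree v.1 := by
  rw [← SimpleGraph.card_neighborFinset_eq_degree, ← SimpleGraph.card_neighborFinset_eq_degree]
  refine Finset.card_le_card_of_injOn Subtype.val ?_ Subtype.val_injective.injOn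
  intro w hw
  simpa using hw

end EdgeCounts

section Ore

open scoped Classical

variable {V : Type*}

theorem countP_add_countP_le {p q : V → Prop} (a : V) (l : List V)
    (h : (a :: l).IsChain fun x y => ¬ (p x ∧ q y))
    (hlast : ∀ x ∈ (a :: l).getLast?, ¬ p x) :
    (a :: l).countP (fun x => p x) + l.countP (fun x => q x) ≤ l.length := by
  induction l generalizing a with
  | nil => simpa [List.countP_cons] using hlast
  | cons b l ih =>
    rw [List.isChain_cons_cons] at h
    have := ih b h.2 (by simpa using hlast)
    rw [List.countP_cons (a := a), List.countP_cons (a := b) (l := l) (p := fun x => decide (q x))]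
    simp only [decide_eq_true_eq, List.length_cons]
    split_ifs <;> first | omega | (exfalso; tauto)

theorem countP_add_countP_lt_length {p q : V → Prop} {l : List V} (hne : l ≠ [])
    (h : l.IsChain fun x y => ¬ (p x ∧ q y))
    (hhead : ∀ x ∈ l.head?, ¬ q x) (hlast : ∀ x ∈ l.getLast?, ¬ p x) :
    l.countP (fun x => p x) + l.countP (fun x => q x) + 1 ≤ l.length := by
  obtain ⟨a, l, rfl⟩ := List.exists_cons_of_ne_nil hne
  have h1 := countP_add_countP_le a l h hlast
  have h2 : ¬ q a := hhead a (by simp)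
  rw [List.countP_cons (p := fun x => decide (q x))]
  simp only [h2, decide_false, List.length_cons]
  simp
  omega

variable [Fintype V]

theorem degree_le_countP (G : SimpleGraph V) (a : V) (l : List V) (h : ∀ z, z ∈ l) :
    G.degree a ≤ l.countP (fun x => G.Adj a x) := by
  rw [← SimpleGraph.card_neighborFinset_eq_degree, List.countP_eq_length_filter]
  refine (Finset.card_le_card ?_).trans (List.toFinset_card_le _)
  intro z hz
  simpa [h z] using hz

theorem mem_of_nodup_of_length_eq_card {l : List V} (hnd : l.Nodup)
    (hl : Fintype.card V ≤ l.length) (z : V) : z ∈ l := by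
  have h1 : l.toFinset.card = l.length := List.toFinset_card_of_nodup hnd
  have h2 : l.toFinset = Finset.univ := by
    apply Finset.eq_univ_of_card
    have := Finset.card_le_univ l.toFinset
    omega
  simpa [h2] using (List.mem_toFinset (a := z) (l := l)).symm

/-- If the vertices split into a path ending in `a` and a path starting in `b`, and there is no
Hamiltonian path, then the degrees of `a` and `b` are small. -/
theorem degree_add_degree_le_of_split {G : SimpleGraph V} (hG : ¬ HasPath G (Fintype.card V))
    {L₁ L₂ : List V} {a b : V} (h₁ : L₁.IsChain G.Adj) (h₂ : L₂.IsChain G.Adj)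
    (hnd : (L₁ ++ L₂).Nodup) (hlen : Fintype.card V ≤ (L₁ ++ L₂).length)
    (ha : L₁.getLast? = some a) (hb : L₂.head? = some b) :
    G.degree a + G.degree b + 2 ≤ Fintype.card V := by
  have key : ∀ l : List V, l.IsChain G.Adj → ¬ l.Perm (L₁ ++ L₂) := by
    intro l hl hp
    exact hG ⟨l, ⟨hl, hp.nodup_iff.2 hnd⟩, hp.length_eq ▸ hlen⟩
  have hne₁ : L₁ ≠ [] := by rintro rfl; simp at ha
  have hne₂ : L₂ ≠ [] := by rintro rfl; simp at hb
  have c₁ := countP_add_countP_lt_length (p := G.Adj a) (q := G.Adj b) hne₁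
    (by
      rw [List.isChain_iff_forall_rel_of_append_cons_cons]
      rintro x y C D rfl ⟨hx, hy⟩
      rw [List.isChain_append_cons_cons] at h₁
      have ha' : (y :: D).getLast? = some a := by simpa using ha
      refine key ((C ++ [x]) ++ ((y :: D).reverse ++ L₂)) ?_ ?_
      · refine List.isChain_append.2 ⟨h₁.1, List.isChain_append.2
          ⟨SimpleGraph.isChain_reverse h₁.2.2, h₂, ?_⟩, ?_⟩
        · simp [hb, hy.symm]
        · rw [List.head?_append, List.head?_reverse, ha']
          simp [hx.symm]
      · rw [← List.append_assoc]
        refine List.Perm.append_right _ ?_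
        have := (List.reverse_perm (y :: D)).append_left (C ++ [x])
        simpa using this)
    (by
      intro x hx hbx
      refine key (L₁.reverse ++ L₂) ?_ ((List.reverse_perm _).append_right _)
      refine List.isChain_append.2 ⟨SimpleGraph.isChain_reverse h₁, h₂, ?_⟩
      rw [List.getLast?_reverse, hb]
      intro u hu v hv
      rw [Option.mem_unique hu hx]
      obtain rfl : b = v := by simpa using hv
      exact hbx.symm)
    (by
      intro x hx
      obtain rfl : a = x := by simpa [ha] using hx
      simp)
  have c₂ := countP_add_countP_lt_length (p := G.Adj a) (q := G.Adj b) hne₂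
    (by
      rw [List.isChain_iff_forall_rel_of_append_cons_cons]
      rintro x y C D rfl ⟨hx, hy⟩
      rw [List.isChain_append_cons_cons] at h₂
      have hb' : (C ++ [x]).head? = some b := by
        cases C <;> simpa using hb
      refine key (L₁ ++ ((C ++ [x]).reverse ++ (y :: D))) ?_ ?_
      · refine List.isChain_append.2 ⟨h₁, List.isChain_append.2
          ⟨SimpleGraph.isChain_reverse h₂.1, h₂.2.2, ?_⟩, ?_⟩
        · rw [List.getLast?_reverse, hb']
          simp [hy]
        · rw [ha]
          simp [hx]
      · refine List.Perm.append_left _ ?_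
        have := (List.reverse_perm (C ++ [x])).append_right (y :: D)
        simpa using this)
    (by
      intro x hx
      obtain rfl : b = x := by simpa [hb] using hx
      simp)
    (by
      intro x hx hax
      refine key (L₁ ++ L₂.reverse) ?_ ((List.reverse_perm _).append_left _)
      refine List.isChain_append.2 ⟨h₁, SimpleGraph.isChain_reverse h₂, ?_⟩
      rw [List.head?_reverse, ha]
      intro u hu v hv
      rw [Option.mem_unique hv hx]
      obtain rfl : a = u := by simpa using hu
      exact hax)
  have hmem := mem_of_nodup_of_length_eq_card hnd hlen
  have d₁ := degree_le_countP G a _ hmem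
  have d₂ := degree_le_countP G b _ hmem
  rw [List.countP_append] at d₁ d₂
  have hle : (L₁ ++ L₂).length ≤ Fintype.card V := hnd.length_le_card
  rw [List.length_append] at hle
  omega

/-- A graph without Hamiltonian path extends to one in which nonadjacent vertices have small
degree sum. -/
theorem exists_le_ore_bound {G : SimpleGraph V} (hG : ¬ HasPath G (Fintype.card V)) :
    ∃ H : SimpleGraph V, G ≤ H ∧ ¬ HasPath H (Fintype.card V) ∧
      ∀ u v, u ≠ v → ¬ H.Adj u v → H.degree u + H.degree v + 2 ≤ Fintype.card V := by
  obtain ⟨H, hGH, hH⟩ := Set.Finite.exists_le_maximal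
    (s := {H : SimpleGraph V | ¬ HasPath H (Fintype.card V)}) (Set.toFinite _) hG
  refine ⟨H, hGH, hH.prop, fun u v huv hadj => ?_⟩
  have hpath : HasPath (H ⊔ SimpleGraph.edge u v) (Fintype.card V) := by
    by_contra hcon
    have hle := hH.le_of_ge (y := H ⊔ SimpleGraph.edge u v) hcon le_sup_left
    exact hadj (hle (Or.inr ((SimpleGraph.edge_adj u v u v).2 ⟨Or.inl ⟨rfl, rfl⟩, huv⟩)))
  obtain ⟨l, ⟨hc, hnd⟩, hl⟩ := hpath
  have hnc : ¬ l.IsChain H.Adj := fun hc' => hH.prop ⟨l, ⟨hc', hnd⟩, hl⟩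
  rw [List.isChain_iff_forall_rel_of_append_cons_cons] at hnc
  push Not at hnc
  obtain ⟨a, b, A, B, rfl, hab⟩ := hnc
  rw [List.isChain_append_cons_cons] at hc
  have hab' : (a = u ∧ b = v) ∨ (a = v ∧ b = u) := by
    rcases hc.2.1 with h | h
    · exact absurd h hab
    · exact ((SimpleGraph.edge_adj _ _ _ _).1 h).1
  have hadj_of : ∀ z, z = a ∨ z = b → ∀ x y, x ≠ z → y ≠ z →
      (H ⊔ SimpleGraph.edge u v).Adj x y → H.Adj x y := by
    intro z hz x y hx hy hxy
    rcases hxy with h | h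
    · exact h
    · have := ((SimpleGraph.edge_adj _ _ _ _).1 h).1
      exfalso
      rcases hab' with ⟨rfl, rfl⟩ | ⟨rfl, rfl⟩ <;> rcases hz with rfl | rfl <;> tauto
  have hA : (A ++ [a]).IsChain H.Adj := by
    refine hc.1.imp_of_mem_imp fun x y hx hy hxy => hadj_of b (Or.inr rfl) x y ?_ ?_ hxy
    · rintro rfl
      simp [List.nodup_append] at hnd hx
      grind
    · rintro rfl
      simp [List.nodup_append] at hnd hy
      grind
  have hB : (b :: B).IsChain H.Adj := by
    refine hc.2.2.imp_of_mem_imp fun x y hx hy hxy => hadj_of a (Or.inl rfl) x y ?_ ?_ hxy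
    · rintro rfl
      simp [List.nodup_append] at hnd hx
      grind
    · rintro rfl
      simp [List.nodup_append] at hnd hy
      grind
  have hres := degree_add_degree_le_of_split hH.prop hA hB (a := a) (b := b)
    (by simpa using hnd) (by simpa using hl) (by simp) (by simp)
  rcases hab' with ⟨rfl, rfl⟩ | ⟨rfl, rfl⟩
  · exact hres
  · omega

theorem exists_ne_not_adj_of_not_hasPath {H : SimpleGraph V}
    (hH : ¬ HasPath H (Fintype.card V)) : ∃ u v, u ≠ v ∧ ¬ H.Adj u v := by
  by_contra hcon
  push Not at hcon
  refine hH ⟨Finset.univ.toList, ⟨?_, Finset.nodup_toList _⟩, by simp⟩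
  exact ((Finset.nodup_toList Finset.univ).imp fun {a b} hab => hcon a b hab).isChain

/-- Degree distribution of a graph satisfying the Ore-type bound: there are `k + 1` vertices of
degree at most `k`, and all but `k` vertices have degree at most `|V| - 2 - k`. -/
theorem exists_degree_profile {H : SimpleGraph V} (hH : ¬ HasPath H (Fintype.card V))
    (hore : ∀ u v, u ≠ v → ¬ H.Adj u v → H.degree u + H.degree v + 2 ≤ Fintype.card V) :
    ∃ (k : ℕ) (A B : Finset V), 2 * k + 2 ≤ Fintype.card V ∧ k + 1 ≤ A.card ∧
      B.card + k = Fintype.card V ∧ (∀ w ∈ A, H.degree w ≤ k) ∧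
      (∀ w ∈ B, H.degree w + 2 + k ≤ Fintype.card V) := by
  obtain ⟨u₀, v₀, h₀⟩ := exists_ne_not_adj_of_not_hasPath hH
  obtain ⟨⟨u, v⟩, huv, hmax⟩ := Finset.exists_max_image
    (Finset.univ.filter fun x : V × V => x.1 ≠ x.2 ∧ ¬ H.Adj x.1 x.2)
    (fun x => H.degree x.1 + H.degree x.2) ⟨(u₀, v₀), by simpa using h₀⟩
  simp only [Finset.mem_filter, Finset.mem_univ, true_and] at huv hmax
  wlog hle : H.degree u ≤ H.degree v generalizing u v
  · refine this v u ⟨huv.1.symm, fun h => huv.2 h.symm⟩ ?_ (by omega)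
    intro x hx
    have := hmax x hx
    omega
  have huv' := hore u v huv.1 huv.2
  refine ⟨H.degree u, Finset.univ.filter fun w => w ≠ v ∧ ¬ H.Adj v w,
    Finset.univ.filter fun w => ¬ H.Adj u w, by omega, ?_, ?_, ?_, ?_⟩
  · have hsub : (Finset.univ : Finset V) ⊆
        insert v (H.neighborFinset v ∪ Finset.univ.filter fun w => w ≠ v ∧ ¬ H.Adj v w) := by
      intro w _
      simp only [Finset.mem_insert, Finset.mem_union, SimpleGraph.mem_neighborFinset,
        Finset.mem_filter, Finset.mem_univ, true_and]
      tauto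
    have h1 := Finset.card_le_card hsub
    have h2 := Finset.card_insert_le v
      (H.neighborFinset v ∪ Finset.univ.filter fun w => w ≠ v ∧ ¬ H.Adj v w)
    have h3 := Finset.card_union_le (H.neighborFinset v)
      (Finset.univ.filter fun w => w ≠ v ∧ ¬ H.Adj v w)
    rw [SimpleGraph.card_neighborFinset_eq_degree] at h3
    rw [Finset.card_univ] at h1
    omega
  · have h1 := Finset.card_filter_add_card_filter_not (s := (Finset.univ : Finset V))
      (fun w => H.Adj u w)
    have h2 : (Finset.univ.filter fun w => H.Adj u w) = H.neighborFinset u := by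
      ext w; simp
    rw [h2, SimpleGraph.card_neighborFinset_eq_degree, Finset.card_univ] at h1
    omega
  · intro w hw
    simp only [Finset.mem_filter, Finset.mem_univ, true_and] at hw
    have := hmax (w, v) ⟨hw.1, fun h => hw.2 h.symm⟩
    simp only at this
    omega
  · intro w hw
    simp only [Finset.mem_filter, Finset.mem_univ, true_and] at hw
    by_cases hwu : w = u
    · subst hwu; omega
    · have := hmax (u, w) ⟨fun h => hwu h.symm, hw⟩
      simp only at this
      omega

end Ore

section NoHamiltonianPath

open scoped Classical

variable {V : Type*} [Fintype V]

theorem degree_add_le_of_profile {H : SimpleGraph V} {k : ℕ} {A B : Finset V}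
    (hk : 2 * k + 2 ≤ Fintype.card V)
    (hA : ∀ w ∈ A, H.degree w ≤ k) (hB : ∀ w ∈ B, H.degree w + 2 + k ≤ Fintype.card V) (w : V) :
    H.degree w + (if w ∈ B then k + 1 else 0) +
      (if w ∈ A then Fintype.card V - (2 * k + 2) else 0) ≤ Fintype.card V - 1 := by
  have h0 := H.degree_lt_card_verts w
  by_cases hwA : w ∈ A <;> by_cases hwB : w ∈ B <;> simp only [hwA, hwB, if_true, if_false] <;>
    first
    | have := hA w hwA; omega
    | have := hB w hwB; omega
    | omega

theorem sum_degree_profile (H : SimpleGraph V) (A B : Finset V) (s t : ℕ) :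
    ∑ w, (H.degree w + (if w ∈ B then s else 0) + (if w ∈ A then t else 0)) =
      2 * H.edgeSet.ncard + B.card * s + A.card * t := by
  rw [Finset.sum_add_distrib, Finset.sum_add_distrib, sum_degree_eq_two_mul_ncard]
  simp [Finset.sum_ite_mem]

theorem two_mul_ncard_add_le_of_profile {H : SimpleGraph V} {k : ℕ} {A B : Finset V}
    (hk : 2 * k + 2 ≤ Fintype.card V)
    (hA : ∀ w ∈ A, H.degree w ≤ k) (hB : ∀ w ∈ B, H.degree w + 2 + k ≤ Fintype.card V) :
    2 * H.edgeSet.ncard + B.card * (k + 1) + A.card * (Fintype.card V - (2 * k + 2)) ≤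
      Fintype.card V * (Fintype.card V - 1) := by
  rw [← sum_degree_profile]
  simpa using Finset.sum_le_sum fun w (_ : w ∈ Finset.univ) => degree_add_le_of_profile hk hA hB w

theorem degree_pos_of_exists_adj {G : SimpleGraph V} {v : V} (h : ∃ w, G.Adj v w) :
    0 < G.degree v := by
  rwa [SimpleGraph.degree_pos_iff_exists_adj]

theorem ncard_edgeSet_le_twelve {G : SimpleGraph V} (hV : Fintype.card V = 7)
    (hP : ¬ HasPath G 7) (hiso : ∀ v, ∃ w, G.Adj v w) : G.edgeSet.ncard ≤ 12 := by
  rw [← hV] at hP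
  obtain ⟨H, hGH, hH, hore⟩ := exists_le_ore_bound hP
  obtain ⟨k, A, B, hk, hkA, hkB, hA, hB⟩ := exists_degree_profile hH hore
  have hsum := two_mul_ncard_add_le_of_profile hk hA hB
  have hle : G.edgeSet.ncard ≤ H.edgeSet.ncard :=
    Set.ncard_le_ncard (SimpleGraph.edgeSet_mono hGH) (Set.toFinite _)
  obtain ⟨x, hx⟩ := Finset.card_pos.1 (show 0 < A.card by omega)
  have hxk := hA x hx
  have hpos : 0 < H.degree x := degree_pos_of_exists_adj ((hiso x).imp fun w hw => hGH hw)
  rw [hV] at hk hkB hsum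
  obtain ⟨hk1, hk2⟩ : 1 ≤ k ∧ k ≤ 2 := by omega
  have hB' : B.card = 7 - k := by omega
  rw [hB'] at hsum
  interval_cases k <;> omega

theorem forall_adj_iff_of_degree_le_one {G : SimpleGraph V} {v : V} (h : G.degree v ≤ 1)
    {p : V} (hp : G.Adj v p) (z : V) : G.Adj v z ↔ z = p := by
  refine ⟨fun hz => ?_, fun hz => hz ▸ hp⟩
  rw [← SimpleGraph.card_neighborFinset_eq_degree] at h
  exact Finset.card_le_one.1 h z (by simpa using hz) p (by simpa using hp)

/-- Adjoining two pendant edges at different vertices to a clique creates a Hamiltonian path. -/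
theorem hasPath_of_clique_of_leaves {H : SimpleGraph V} {x y p q : V} (hxy : x ≠ y)
    (hpq : p ≠ q) (hxp : H.Adj x p) (hyq : H.Adj y q) (hyp : p ≠ y) (hxq : q ≠ x)
    (hK : ∀ w z, w ≠ x → w ≠ y → z ≠ x → z ≠ y → w ≠ z → H.Adj w z) :
    HasPath H (Fintype.card V) := by
  have hpx : p ≠ x := hxp.ne'
  have hqy : q ≠ y := hyq.ne'
  set R : Finset V := ({x, y, p, q} : Finset V)ᶜ with hR
  have hRc : R.card + 4 = Fintype.card V := by
    have h4 : ({x, y, p, q} : Finset V).card = 4 := by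
      simp [Finset.card_insert_of_notMem, hxy, hpx.symm, hxq.symm, hyp.symm, hqy.symm, hpq]
    have := Finset.card_le_univ ({x, y, p, q} : Finset V)
    rw [hR, Finset.card_compl]
    omega
  have hmem : ∀ w ∈ R.toList, w ≠ x ∧ w ≠ y ∧ w ≠ p ∧ w ≠ q := by
    intro w hw
    simpa [hR] using hw
  have hmid : ((p :: R.toList) ++ [q]).Nodup := by
    simp only [List.cons_append, List.nodup_cons, List.nodup_append, List.mem_append,
      List.mem_singleton, R.nodup_toList, true_and]
    refine ⟨?_, ?_⟩
    · rintro (h | h)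
      · exact (hmem p h).2.2.1 rfl
      · exact hpq h
    · exact ⟨by simp, fun a ha b hb hab => (hmem a ha).2.2.2 (hab.trans hb)⟩
  have hmidmem : ∀ w ∈ (p :: R.toList) ++ [q], w ≠ x ∧ w ≠ y := by
    intro w hw
    simp only [List.cons_append, List.mem_cons, List.mem_append, List.not_mem_nil, or_false] at hw
    rcases hw with rfl | h | rfl
    · exact ⟨hpx, hyp⟩
    · exact ⟨(hmem w h).1, (hmem w h).2.1⟩
    · exact ⟨hxq, hqy⟩
  have hmidchain : ((p :: R.toList) ++ [q]).IsChain H.Adj :=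
    (hmid.imp_of_mem fun {a b} ha hb hab =>
      hK a b (hmidmem a ha).1 (hmidmem a ha).2 (hmidmem b hb).1 (hmidmem b hb).2 hab).isChain
  refine ⟨x :: (((p :: R.toList) ++ [q]) ++ [y]), ⟨?_, ?_⟩, ?_⟩
  · refine List.isChain_cons.2 ⟨by simpa using hxp, List.isChain_append.2
      ⟨hmidchain, List.isChain_singleton _, ?_⟩⟩
    rw [List.getLast?_append]
    simpa using hyq.symm
  · rw [List.nodup_cons, List.nodup_append']
    refine ⟨?_, hmid, List.nodup_singleton _, ?_⟩
    · rw [List.mem_append, List.mem_singleton]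
      rintro (h | h)
      · exact (hmidmem x h).1 rfl
      · exact hxy h
    · intro w hw hw'
      exact (hmidmem w hw).2 (by simpa using hw')
  · simp
    omega

theorem exists_two_leaves {G : SimpleGraph V} (hV : Fintype.card V = 14)
    (hP : ¬ HasPath G 14) (he : 63 ≤ G.edgeSet.ncard) (h5 : ∃ v, G.degree v ≤ 5)
    (hiso : ∀ v, ∃ w, G.Adj v w) :
    ∃ x y p q, x ≠ y ∧ (∀ z, G.Adj x z ↔ z = p) ∧ (∀ z, G.Adj y z ↔ z = q) ∧
      (p = q ∨ G.Adj x y) := by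
  rw [← hV] at hP
  obtain ⟨H, hGH, hH, hore⟩ := exists_le_ore_bound hP
  obtain ⟨k, A, B, hk, hkA, hkB, hA, hB⟩ := exists_degree_profile hH hore
  have hsum := two_mul_ncard_add_le_of_profile hk hA hB
  have hle : G.edgeSet.ncard ≤ H.edgeSet.ncard :=
    Set.ncard_le_ncard (SimpleGraph.edgeSet_mono hGH) (Set.toFinite _)
  have hpos : ∀ v, 0 < H.degree v := fun v =>
    degree_pos_of_exists_adj ((hiso v).imp fun w hw => hGH hw)
  have hk1 : k = 1 := by
    obtain ⟨x, hx⟩ := Finset.card_pos.1 (show 0 < A.card by omega)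
    have hxk := hA x hx
    have hxpos := hpos x
    rw [hV] at hsum
    have hB' : B.card = 14 - k := by omega
    rw [hB'] at hsum
    obtain ⟨hk1, hk2⟩ : 1 ≤ k ∧ k ≤ 6 := by omega
    by_contra hne
    have hk6 : k = 6 := by interval_cases k <;> omega
    subst hk6
    obtain ⟨v, hv⟩ := h5
    have hGHeq : G = H := by
      apply SimpleGraph.edgeSet_injective
      exact Set.eq_of_subset_of_ncard_le (SimpleGraph.edgeSet_mono hGH) (by omega) (Set.toFinite _)
    subst hGHeq
    have hlt := Finset.sum_lt_sum (s := Finset.univ)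
      (fun w _ => degree_add_le_of_profile hk hA hB w) ⟨v, Finset.mem_univ v, by
        simp only [hV]
        split_ifs <;> omega⟩
    rw [sum_degree_profile, Finset.sum_const, Finset.card_univ, hV, hB'] at hlt
    simp at hlt
    omega
  subst hk1
  obtain ⟨x, hx, y, hy, hxy⟩ := Finset.one_lt_card.1 (show 1 < A.card by omega)
  have hdx := hA x hx
  have hdy := hA y hy
  obtain ⟨p, hp⟩ := hiso x
  obtain ⟨q, hq⟩ := hiso y
  have hHx := forall_adj_iff_of_degree_le_one hdx (hGH hp)
  have hHy := forall_adj_iff_of_degree_le_one hdy (hGH hq)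
  refine ⟨x, y, p, q, hxy, fun z => ⟨fun h => (hHx z).1 (hGH h), fun h => h ▸ hp⟩,
    fun z => ⟨fun h => (hHy z).1 (hGH h), fun h => h ▸ hq⟩, ?_⟩
  by_contra hcon
  push Not at hcon
  obtain ⟨hpq, hadj⟩ := hcon
  refine hH (hasPath_of_clique_of_leaves hxy hpq (hGH hp) (hGH hq) ?_ ?_ ?_)
  · rintro rfl; exact hadj hp
  · rintro rfl; exact hadj hq.symm
  · intro w z hwx hwy hzx hzy hwz
    by_contra hwzadj
    have h1 := hore w z hwz hwzadj
    have h2 := ncard_edgeSet_le_induce_add_sum_degree H ({x, y, w, z} : Finset V)ᶜ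
    have h4 : ({x, y, w, z} : Finset V).card = 4 := by
      simp [Finset.card_insert_of_notMem, hxy, hwx.symm, hwy.symm, hzx.symm, hzy.symm, hwz]
    have h3 := ncard_edgeSet_induce_le_choose H ({x, y, w, z} : Finset V)ᶜ
    rw [Finset.card_compl, h4, hV] at h3
    rw [compl_compl, Finset.sum_insert (by simp [hxy, hwx.symm, hzx.symm]),
      Finset.sum_insert (by simp [hwy.symm, hzy.symm]), Finset.sum_pair hwz] at h2
    simp [Nat.choose] at h3
    omega

end NoHamiltonianPath

section LongestPath

open scoped Classical

theorem two_mul_card_le_of_no_consecutive {I : Finset ℕ} {lo hi : ℕ}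
    (hI : ∀ i ∈ I, lo ≤ i ∧ i ≤ hi) (hcons : ∀ i ∈ I, i + 1 ∉ I) (hle : lo ≤ hi) :
    2 * I.card ≤ hi - lo + 2 := by
  have h : I.card ≤ (Finset.range ((hi - lo) / 2 + 1)).card := by
    refine Finset.card_le_card_of_injOn (fun i => (i - lo) / 2) ?_ ?_
    · intro i hi'
      have := hI i hi'
      simp only [Finset.coe_range, Set.mem_Iio]
      omega
    · intro i hi' j hj' hij
      have h1 := hI i hi'
      have h2 := hI j hj'
      simp only at hij
      have h3 : j ≠ i + 1 := fun h => hcons i hi' (h ▸ hj')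
      have h4 : i ≠ j + 1 := fun h => hcons j hj' (h ▸ hi')
      omega
  rw [Finset.card_range] at h
  omega

theorem eq_six_of_attachment_indices {I : Finset ℕ} {k j : ℕ} (hk : 1 ≤ k)
    (hI : ∀ i ∈ I, k ≤ i ∧ i + k ≤ 12 ∧ i ≠ 5 ∧ i ≠ 7) (hcons : ∀ i ∈ I, i + 1 ∉ I)
    (hj : k ≤ j ∧ j + k ≤ 12)
    (hij : ∀ i ∈ I, (i < j → i + 1 + k ≤ j) ∧ (j < i → j + 1 + k ≤ i))
    (hcard : 7 ≤ I.card + k) : k = 6 ∧ j = 6 := by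
  have hsub : I ⊆ Finset.range 13 := by
    intro i hi
    have := hI i hi
    rw [Finset.mem_range]
    omega
  obtain ⟨b, hb⟩ : ∃ b : ℕ → ℕ, ∀ i, b i = if i ∈ I then 1 else 0 := ⟨_, fun _ => rfl⟩
  have hsum : I.card = ∑ i ∈ Finset.range 13, b i := by
    simp only [hb]
    rw [Finset.sum_ite_mem, Finset.inter_eq_right.2 hsub]
    simp
  have h1 : ∀ i, b i + b (i + 1) ≤ 1 := by
    intro i
    have := hcons i
    simp only [hb]
    split_ifs <;> first | omega | tauto
  have h2 : ∀ i, b i = 0 ∨ (k ≤ i ∧ i + k ≤ 12 ∧ i ≠ 5 ∧ i ≠ 7) := by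
    intro i
    by_cases hi : i ∈ I
    · exact Or.inr (hI i hi)
    · exact Or.inl (by simp [hb, hi])
  have h3 : ∀ i, b i ≠ 0 → (i < j → i + 1 + k ≤ j) ∧ (j < i → j + 1 + k ≤ i) := by
    intro i hi
    refine hij i ?_
    by_contra h
    exact hi (by simp [hb, h])
  simp only [Finset.sum_range_succ, Finset.sum_range_zero] at hsum
  have a1 := h1 1
  have a2 := h1 2
  have a3 := h1 3
  have a8 := h1 8
  have a9 := h1 9
  have a10 := h1 10
  have c0 := h2 0
  have c1 := h2 1
  have c2 := h2 2
  have c3 := h2 3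
  have c4 := h2 4
  have c5 := h2 5
  have c6 := h2 6
  have c7 := h2 7
  have c8 := h2 8
  have c9 := h2 9
  have c10 := h2 10
  have c11 := h2 11
  have c12 := h2 12
  have b4 := h1 4
  have b6 := h1 6
  norm_num at a1 a2 a3 a8 a9 a10 b4 b6
  have hk6 : k ≤ 6 := by omega
  clear hb h1 h2 hI hcons hij hsub
  interval_cases k <;> norm_num at c0 c1 c2 c3 c4 c5 c6 c7 c8 c9 c10 c11 c12
  · omega
  · have d4 := h3 4 (by omega)
    have d6 := h3 6 (by omega)
    have d8 := h3 8 (by omega)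
    omega
  · omega
  · have d4 := h3 4 (by omega)
    have d6 := h3 6 (by omega)
    have d8 := h3 8 (by omega)
    omega
  · omega
  · omega

variable {V : Type*}

theorem isChain_mem_or_notMem {G : SimpleGraph V} {T : Set V} {l : List V}
    (h : l.IsChain G.Adj) (hT : ∀ a ∈ l, ∀ b ∈ l, G.Adj a b → a ∈ T → b ∈ T) :
    (∀ z ∈ l, z ∈ T) ∨ ∀ z ∈ l, z ∉ T := by
  induction l with
  | nil => simp
  | cons a l ih =>
    cases l with
    | nil => simp; tauto
    | cons b l =>
      rw [List.isChain_cons_cons] at h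
      have h1 := hT a (by simp) b (by simp) h.1
      have h2 := hT b (by simp) a (by simp) h.1.symm
      rcases ih h.2 (fun x hx y hy => hT x (by simp [hx]) y (by simp [hy])) with h3 | h3
      · left
        intro z hz
        rcases List.mem_cons.1 hz with rfl | hz
        · exact h2 (h3 b (by simp))
        · exact h3 z hz
      · right
        intro z hz
        rcases List.mem_cons.1 hz with rfl | hz
        · exact fun hz => h3 b (by simp) (h1 hz)
        · exact h3 z hz

/-- Deleting a vertex whose neighbours all lie on a path avoiding it keeps the graph connected. -/
theorem cutConnected_induce_compl {G : SimpleGraph V} (hc : CutConnected G) {x p : V}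
    {X P : List V} (hP : P.IsChain G.Adj) (hX : (X ++ [p]).IsChain G.Adj) (hp : p ∈ P)
    (hxP : x ∉ P) (hxX : x ∉ X) (hN : ∀ z, G.Adj x z → z ∈ X ∨ z ∈ P) :
    CutConnected (G.induce ({x}ᶜ : Set V)) := by
  have main : ∀ T : Set V, x ∉ T → (∀ a ∈ T, ∀ b, b ≠ x → G.Adj a b → b ∈ T) →
      (∀ z ∈ P, z ∉ T) → T = ∅ := by
    intro T hxT hT hPT
    have hXT : ∀ z ∈ X ++ [p], z ∉ T := by
      rcases isChain_mem_or_notMem (T := T) hX (fun a _ b hb hab ha => hT a ha b (by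
        rintro rfl
        rcases List.mem_append.1 hb with h | h
        · exact hxX h
        · exact hxP (by rw [List.mem_singleton] at h; exact h ▸ hp)) hab) with h | h
      · exact absurd (h p (by simp)) (hPT p hp)
      · exact h
    rcases hc T (fun a ha b hab => by
      by_cases hbx : b = x
      · subst hbx
        rcases hN a hab.symm with h | h
        · exact absurd ha (hXT a (by simp [h]))
        · exact absurd ha (hPT a h)
      · exact hT a ha b hbx hab) with h | h
    · exact h
    · exact absurd (h ▸ Set.mem_univ x) hxT
  intro S hS
  have hcl : ∀ a ∈ Subtype.val '' S, ∀ b, b ≠ x → G.Adj a b → b ∈ Subtype.val '' S := by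
    rintro _ ⟨a, ha, rfl⟩ b hb hab
    exact ⟨⟨b, hb⟩, hS a ha ⟨b, hb⟩ hab, rfl⟩
  rcases isChain_mem_or_notMem (T := Subtype.val '' S) hP (fun a _ b hb hab ha => hcl a ha b (by
    rintro rfl; exact hxP hb) hab) with h | h
  · right
    have := main (Subtype.val '' Sᶜ) (by rintro ⟨a, -, h⟩; exact a.2 h) (by
      rintro _ ⟨a, ha, rfl⟩ b hb hab
      refine ⟨⟨b, hb⟩, fun hbS => ha ?_, rfl⟩
      exact hS _ hbS a (hab : G.Adj _ _).symm) (by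
      rintro z hz ⟨a, ha, rfl⟩
      obtain ⟨a', ha', haa⟩ := h _ hz
      exact ha (Subtype.ext haa ▸ ha'))
    rw [Set.image_eq_empty] at this
    simpa using this
  · left
    have := main _ (by rintro ⟨a, -, h⟩; exact a.2 h) hcl h
    simpa using this

theorem length_le_of_attached {G : SimpleGraph V} {P X : List V} (hP : IsPathList G P)
    (hmax : ∀ l, IsPathList G l → l.length ≤ P.length) (hX : X.Nodup)
    (hdisj : ∀ z ∈ X, z ∉ P) {i : ℕ} (hi : i < P.length)
    (hch : (X ++ [P[i]]).IsChain G.Adj) : X.length ≤ i ∧ X.length + i + 1 ≤ P.length := by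
  constructor
  · have h1 : IsPathList G (X ++ P.drop i) := by
      refine ⟨?_, ?_⟩
      · have := hP.1.drop i
        rw [List.drop_eq_getElem_cons hi] at this ⊢
        exact List.isChain_split.2 ⟨hch, this⟩
      · refine List.nodup_append'.2 ⟨hX, hP.2.sublist (List.drop_sublist _ _), ?_⟩
        exact fun z hz hz' => hdisj z hz (List.mem_of_mem_drop hz')
    have := hmax _ h1
    simp at this
    omega
  · have h1 : IsPathList G (X ++ (P.take (i + 1)).reverse) := by
      refine ⟨?_, ?_⟩
      · have := SimpleGraph.isChain_reverse (hP.1.take (i + 1))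
        rw [List.take_add_one, List.getElem?_eq_getElem hi] at this ⊢
        simp only [Option.toList_some, List.reverse_append, List.reverse_cons, List.reverse_nil,
          List.nil_append, List.singleton_append] at this ⊢
        exact List.isChain_split.2 ⟨hch, this⟩
      · refine List.nodup_append'.2 ⟨hX,
          List.nodup_reverse.2 (hP.2.sublist (List.take_sublist _ _)), ?_⟩
        exact fun z hz hz' => hdisj z hz (List.mem_of_mem_take (List.mem_reverse.1 hz'))
    have := hmax _ h1
    simp at this
    omega

theorem length_le_of_detour {G : SimpleGraph V} {P X : List V} (hP : IsPathList G P)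
    (hmax : ∀ l, IsPathList G l → l.length ≤ P.length) (hX : X.Nodup)
    (hdisj : ∀ z ∈ X, z ∉ P) {i j : ℕ} (hij : i < j) (hj : j < P.length)
    (hch : (P[i] :: (X ++ [P[j]])).IsChain G.Adj) : i + 1 + X.length ≤ j := by
  have hi : i < P.length := by omega
  have h1 : IsPathList G (P.take (i + 1) ++ (X ++ P.drop j)) := by
    refine ⟨?_, ?_⟩
    · have h2 := hP.1.take (i + 1)
      have h3 := hP.1.drop j
      rw [List.drop_eq_getElem_cons hj] at h3 ⊢
      rw [List.take_add_one, List.getElem?_eq_getElem hi] at h2 ⊢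
      simp only [Option.toList_some, List.append_assoc, List.singleton_append] at h2 ⊢
      refine List.isChain_split.2 ⟨h2, ?_⟩
      rw [← List.cons_append] at hch ⊢
      exact List.isChain_split.2 ⟨hch, h3⟩
    · have hsplit : (P.take (i + 1) ++ P.drop j).Nodup := by
        refine hP.2.sublist ?_
        have h4 : (P.drop j).Sublist (P.drop (i + 1)) := by
          have : j = (i + 1) + (j - (i + 1)) := by omega
          rw [this, ← List.drop_drop]
          exact List.drop_sublist _ _
        have := h4.append_left (P.take (i + 1))
        rwa [List.take_append_drop] at this
      rw [List.nodup_append'] at hsplit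
      refine List.nodup_append'.2 ⟨hsplit.1, List.nodup_append'.2 ⟨hX, hsplit.2.1, ?_⟩, ?_⟩
      · exact fun z hz hz' => hdisj z hz (List.mem_of_mem_drop hz')
      · intro z hz hz'
        rcases List.mem_append.1 hz' with h | h
        · exact hdisj z h (List.mem_of_mem_take hz)
        · exact hsplit.2.2 hz h
  have := hmax _ h1
  simp at this
  omega

theorem hasTwoPaths_of_attached {G : SimpleGraph V} {P : List V} (hP : IsPathList G P)
    (hlen : P.length = 13) {x : V} (hx : x ∉ P) {i : ℕ} (hi : i < P.length)
    (hadj : G.Adj x P[i]) (h57 : i = 5 ∨ i = 7) : HasTwoPaths G := by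
  have hnd : (P.take (i + 1) ++ P.drop (i + 1)).Nodup := by simpa using hP.2
  rcases h57 with rfl | rfl
  · refine ⟨P.take 6 ++ [x], P.drop 6, ?_, hP.1.drop _, ?_, ?_, ?_⟩
    · have h2 := hP.1.take 6
      rw [List.take_add_one (i := 5), List.getElem?_eq_getElem hi] at h2 ⊢
      simp only [Option.toList_some, List.append_assoc, List.singleton_append] at h2 ⊢
      exact List.isChain_append_cons_cons.2 ⟨h2, hadj.symm, List.isChain_singleton _⟩
    · have : (P.take 6 ++ [x] ++ P.drop 6).Perm (x :: P) := by
        rw [List.append_assoc, List.singleton_append]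
        refine List.perm_middle.trans ?_
        rw [List.take_append_drop]
      rw [this.nodup_iff, List.nodup_cons]
      exact ⟨hx, hP.2⟩
    · simp [hlen]
    · simp [hlen]
  · refine ⟨P.take 7, x :: P.drop 7, hP.1.take _, ?_, ?_, ?_, ?_⟩
    · have h2 := hP.1.drop 7
      rw [List.drop_eq_getElem_cons hi] at h2 ⊢
      exact List.isChain_cons_cons.2 ⟨hadj, h2⟩
    · have : (P.take 7 ++ x :: P.drop 7).Perm (x :: P) := by
        refine List.perm_middle.trans ?_
        rw [List.take_append_drop]
      rw [this.nodup_iff, List.nodup_cons]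
      exact ⟨hx, hP.2⟩
    · simp [hlen]
    · simp [hlen]

end LongestPath

section Removal

open scoped Classical

variable {V : Type*}

theorem exists_length_max {Q : List V → Prop} {N : ℕ} (h : ∃ L, Q L)
    (hN : ∀ L, Q L → L.length ≤ N) : ∃ L, Q L ∧ ∀ L', Q L' → L'.length ≤ L.length := by
  obtain ⟨L₀, h₀⟩ := h
  have h1 : ∃ L, Q L ∧ L.length = Nat.findGreatest (fun n => ∃ L, Q L ∧ L.length = n) N :=
    Nat.findGreatest_spec (P := fun n => ∃ L, Q L ∧ L.length = n) (hN _ h₀) ⟨L₀, h₀, rfl⟩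
  obtain ⟨L, hL, hlen⟩ := h1
  refine ⟨L, hL, fun L' hL' => ?_⟩
  rw [hlen]
  exact Nat.le_findGreatest (hN _ hL') ⟨L', hL', rfl⟩

variable [Fintype V]

theorem exists_longest_path [Nonempty V] (G : SimpleGraph V) :
    ∃ P, IsPathList G P ∧ P ≠ [] ∧ ∀ l, IsPathList G l → l.length ≤ P.length := by
  obtain ⟨v⟩ := ‹Nonempty V›
  have hv : IsPathList G [v] := ⟨List.isChain_singleton _, List.nodup_singleton _⟩
  obtain ⟨P, hP, hmax⟩ := exists_length_max (Q := IsPathList G) ⟨_, hv⟩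
    (fun L hL => hL.2.length_le_card)
  refine ⟨P, hP, ?_, hmax⟩
  rintro rfl
  simpa using hmax _ hv

theorem exists_pendant_path {G : SimpleGraph V} (hc : CutConnected G) {P : List V}
    (hP : P.Nodup) (hne : P ≠ []) (hlt : P.length < Fintype.card V) :
    ∃ x X p, p ∈ P ∧ (x :: X ++ [p]).IsChain G.Adj ∧ (x :: X).Nodup ∧
      (∀ z ∈ x :: X, z ∉ P) ∧ ∀ z, G.Adj x z → z ∈ X ∨ z ∈ P := by
  have hex : ∃ p ∈ P, ∃ x, x ∉ P ∧ G.Adj p x := by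
    by_contra! h
    rcases hc {v | v ∈ P} (fun a ha b hab => by_contra fun hb => h a ha b hb hab) with h0 | h0
    · obtain ⟨a, ha⟩ := List.exists_mem_of_ne_nil _ hne
      exact Set.eq_empty_iff_forall_notMem.1 h0 a ha
    · have : P.toFinset = Finset.univ := by
        ext v
        simpa using Set.eq_univ_iff_forall.1 h0 v
      rw [← List.toFinset_card_of_nodup hP, this, Finset.card_univ] at hlt
      exact lt_irrefl _ hlt
  obtain ⟨L, ⟨hL0, p, hp, hch, hnd, hdisj⟩, hmax⟩ := exists_length_max (N := Fintype.card V)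
    (Q := fun L => L ≠ [] ∧ ∃ p ∈ P, (L ++ [p]).IsChain G.Adj ∧ L.Nodup ∧ ∀ z ∈ L, z ∉ P) (by
      obtain ⟨p, hp, x, hx, hpx⟩ := hex
      exact ⟨[x], by simp, p, hp, by simpa using hpx.symm, by simp, by simpa using hx⟩)
    (fun L hL => hL.2.choose_spec.2.2.1.length_le_card)
  obtain ⟨x, X, rfl⟩ := List.exists_cons_of_ne_nil hL0
  refine ⟨x, X, p, hp, hch, hnd, hdisj, fun z hz => ?_⟩
  by_contra! h
  have := hmax (z :: x :: X) ⟨by simp, p, hp, ?_, ?_, ?_⟩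
  · simp at this
  · exact List.isChain_cons_cons.2 ⟨hz.symm, hch⟩
  · refine List.nodup_cons.2 ⟨?_, hnd⟩
    simpa using ⟨hz.ne', h.1⟩
  · intro w hw
    rcases List.mem_cons.1 hw with rfl | hw
    · exact h.2
    · exact hdisj w hw

theorem exists_attachment_indices {G : SimpleGraph V} {P : List V} (hP : IsPathList G P)
    (hmax : ∀ l, IsPathList G l → l.length ≤ P.length) {x : V} {X : List V} {j : ℕ}
    (hj : j < P.length) (hch : (x :: X ++ [P[j]]).IsChain G.Adj) (hnd : (x :: X).Nodup)
    (hdisj : ∀ z ∈ x :: X, z ∉ P) (hN : ∀ z, G.Adj x z → z ∈ X ∨ z ∈ P) :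
    ∃ I : Finset ℕ, (∀ i ∈ I, ∃ h : i < P.length, G.Adj x P[i]) ∧
      (∀ i ∈ I, X.length + 1 ≤ i ∧ X.length + 1 + i + 1 ≤ P.length) ∧ (∀ i ∈ I, i + 1 ∉ I) ∧
      (∀ i ∈ I, (i < j → i + 1 + (X.length + 1) ≤ j) ∧ (j < i → j + 1 + (X.length + 1) ≤ i)) ∧
      G.degree x ≤ X.length + I.card := by
  set I := (Finset.range P.length).filter (fun i => ∃ h : i < P.length, G.Adj x P[i]) with hI
  have hmem : ∀ i ∈ I, ∃ h : i < P.length, G.Adj x P[i] := fun i hi =>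
    (Finset.mem_filter.1 hi).2
  have hrevnd : (x :: X).reverse.Nodup := List.nodup_reverse.2 hnd
  have hrevdisj : ∀ z ∈ (x :: X).reverse, z ∉ P := fun z hz => hdisj z (List.mem_reverse.1 hz)
  refine ⟨I, hmem, fun i hi => ?_, fun i hi hi' => ?_, fun i hi => ⟨fun hij => ?_, fun hij => ?_⟩,
    ?_⟩
  · obtain ⟨hlt, hadj⟩ := hmem i hi
    have := length_le_of_attached hP hmax hrevnd hrevdisj hlt (by
      have h1 : (P[i] :: x :: X).IsChain G.Adj :=
        List.isChain_cons_cons.2 ⟨hadj.symm, hch.left_of_append⟩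
      simpa using SimpleGraph.isChain_reverse h1)
    simpa using this
  · obtain ⟨hlt, hadj⟩ := hmem i hi
    obtain ⟨hlt', hadj'⟩ := hmem _ hi'
    have := length_le_of_detour hP hmax (X := [x]) (by simp) (by simpa using hdisj x (by simp))
      (Nat.lt_succ_self i) hlt' (by simpa using ⟨hadj.symm, hadj'⟩)
    simp at this
  · obtain ⟨hlt, hadj⟩ := hmem i hi
    simpa using length_le_of_detour hP hmax hnd hdisj hij hj
      (List.isChain_cons_cons.2 ⟨hadj.symm, hch⟩)
  · obtain ⟨hlt, hadj⟩ := hmem i hi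
    have := length_le_of_detour hP hmax hrevnd hrevdisj hij hlt (by
      have h1 : (P[i] :: (x :: X ++ [P[j]])).IsChain G.Adj :=
        List.isChain_cons_cons.2 ⟨hadj.symm, hch⟩
      simpa using SimpleGraph.isChain_reverse h1)
    simpa using this
  · rw [← SimpleGraph.card_neighborFinset_eq_degree]
    have hsub : G.neighborFinset x ⊆ X.toFinset ∪ I.image (fun i => P.getD i x) := by
      intro z hz
      rw [SimpleGraph.mem_neighborFinset] at hz
      rw [Finset.mem_union]
      rcases hN z hz with h | h
      · left; simpa using h
      · right
        obtain ⟨i, hi, rfl⟩ := List.mem_iff_getElem.1 h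
        refine Finset.mem_image.2 ⟨i, ?_, by simp [hi]⟩
        rw [hI, Finset.mem_filter]
        exact ⟨Finset.mem_range.2 hi, hi, hz⟩
    refine (Finset.card_le_card hsub).trans ((Finset.card_union_le _ _).trans ?_)
    exact add_le_add (List.toFinset_card_le _) Finset.card_image_le

/-- A connected graph with a longest path missing a vertex has a vertex of small degree whose
deletion keeps the graph connected. -/
theorem exists_removable {G : SimpleGraph V} (hc : CutConnected G) {P : List V}
    (hP : IsPathList G P) (hne : P ≠ [])
    (hmax : ∀ l, IsPathList G l → l.length ≤ P.length) (hlt : P.length < Fintype.card V) :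
    ∃ x, CutConnected (G.induce ({x}ᶜ : Set V)) ∧ 2 * G.degree x + 1 ≤ P.length ∧
      (¬ HasTwoPaths G → ∀ h13 : P.length = 13, 6 ≤ G.degree x →
        ∃ X : List V, X.length = 6 ∧ (X ++ [P[6]]).IsChain G.Adj ∧ X.Nodup ∧ ∀ z ∈ X, z ∉ P) := by
  obtain ⟨x, X, p, hp, hch, hnd, hdisj, hN⟩ := exists_pendant_path hc hP.2 hne hlt
  have hcon := cutConnected_induce_compl hc hP.1 (List.IsChain.tail hch) hp
    (hdisj x (by simp)) (List.nodup_cons.1 hnd).1 hN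
  obtain ⟨j, hj, rfl⟩ := List.mem_iff_getElem.1 hp
  obtain ⟨I, hI1, hI2, hI3, hI4, hdeg⟩ :=
    exists_attachment_indices hP hmax hj hch hnd hdisj hN
  have hjk : X.length + 1 ≤ j ∧ X.length + 1 + j + 1 ≤ P.length := by
    simpa using length_le_of_attached hP hmax hnd hdisj hj hch
  have hcardI := two_mul_card_le_of_no_consecutive (lo := X.length + 1)
    (hi := P.length - (X.length + 2)) (fun i hi => ⟨(hI2 i hi).1, by have := hI2 i hi; omega⟩) hI3
    (by omega)
  refine ⟨x, hcon, by omega, fun hno h13 h6 => ?_⟩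
  have h57 : ∀ i ∈ I, ¬ (i = 5 ∨ i = 7) := by
    intro i hi h
    obtain ⟨hlt, hadj⟩ := hI1 i hi
    exact hno (hasTwoPaths_of_attached hP h13 (hdisj x (by simp)) hlt hadj h)
  obtain ⟨hk, rfl⟩ := eq_six_of_attachment_indices (I := I) (k := X.length + 1) (j := j)
    (by omega) (fun i hi => by have := hI2 i hi; have := h57 i hi; omega) hI3
    (by omega) hI4 (by omega)
  exact ⟨x :: X, by simpa using hk, hch, hnd, hdisj⟩

end Removal

section Arms

open scoped Classical

variable {V : Type*}

/-- `L` is a path on six vertices whose last vertex is joined to the further vertex `c`. -/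
def IsArm (G : SimpleGraph V) (c : V) (L : List V) : Prop :=
  (L ++ [c]).IsChain G.Adj ∧ L.Nodup ∧ c ∉ L ∧ L.length = 6

theorem exists_half_path {G : SimpleGraph V} {L : List V} (hL : IsPathList G L)
    (hlen : 6 ≤ L.length) {a : V} (ha : a ∈ L) :
    ∃ S, IsPathList G (a :: S) ∧ (∀ z ∈ a :: S, z ∈ L) ∧ 3 ≤ S.length := by
  obtain ⟨A, B, rfl⟩ := List.append_of_mem ha
  obtain ⟨hc, hnd⟩ := hL
  have hnd' := hnd
  rw [List.nodup_append'] at hnd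
  simp only [List.length_append, List.length_cons] at hlen
  by_cases h : 3 ≤ B.length
  · exact ⟨B, ⟨hc.right_of_append, hnd.2.1⟩, fun z hz => List.mem_append_right _ hz, h⟩
  · refine ⟨A.reverse, ⟨?_, ?_⟩, ?_, by rw [List.length_reverse]; omega⟩
    · have : (A ++ [a]).IsChain G.Adj := by
        rw [List.isChain_split] at hc
        exact hc.1
      simpa using SimpleGraph.isChain_reverse this
    · rw [List.nodup_cons, List.mem_reverse, List.nodup_reverse]
      exact ⟨fun h => hnd.2.2 h (by simp), hnd.1⟩
    · intro z hz
      rcases List.mem_cons.1 hz with rfl | hz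
      · simp
      · exact List.mem_append_left _ (List.mem_reverse.1 hz)

theorem hasTwoPaths_of_adj_arms {G : SimpleGraph V} {c : V} {A B C : List V} (hA : IsArm G c A)
    (hB : IsArm G c B) (hC : IsArm G c C) (hAB : A.Disjoint B) (hAC : A.Disjoint C)
    (hBC : B.Disjoint C) {a b : V} (ha : a ∈ A) (hb : b ∈ B) (hab : G.Adj a b) :
    HasTwoPaths G := by
  obtain ⟨S, hS, hSA, hS3⟩ := exists_half_path ⟨hA.1.left_of_append, hA.2.1⟩ hA.2.2.2.ge ha
  obtain ⟨T, hT, hTB, hT3⟩ := exists_half_path ⟨hB.1.left_of_append, hB.2.1⟩ hB.2.2.2.ge hb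
  refine ⟨(a :: S).reverse ++ (b :: T), C ++ [c], ?_, hC.1, ?_, ?_, ?_⟩
  · have h1 := SimpleGraph.isChain_reverse hS.1
    rw [List.reverse_cons] at h1 ⊢
    rw [List.append_assoc, List.singleton_append]
    exact List.isChain_append_cons_cons.2 ⟨h1, hab, hT.1⟩
  · refine List.nodup_append'.2 ⟨List.nodup_append'.2 ⟨List.nodup_reverse.2 hS.2, hT.2, ?_⟩,
      List.nodup_append'.2 ⟨hC.2.1, List.nodup_singleton _, ?_⟩, ?_⟩
    · exact fun z hz hz' => hAB (hSA z (List.mem_reverse.1 hz)) (hTB z hz')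
    · intro z hz hz'
      rw [List.mem_singleton] at hz'
      exact hC.2.2.1 (hz' ▸ hz)
    · intro z hz hz'
      rcases List.mem_append.1 hz with h | h <;> rcases List.mem_append.1 hz' with h' | h'
      · exact hAC (hSA z (List.mem_reverse.1 h)) h'
      · rw [List.mem_singleton] at h'
        exact hA.2.2.1 (h' ▸ hSA z (List.mem_reverse.1 h))
      · exact hBC (hTB z h) h'
      · rw [List.mem_singleton] at h'
        exact hB.2.2.1 (h' ▸ hTB z h)
  · simp; omega
  · simp [hC.2.2.2]

variable [Fintype V]

theorem degree_le_of_mem_arm {G : SimpleGraph V} (hno : ¬ HasTwoPaths G) {c : V} {A B C : List V}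
    (hA : IsArm G c A) (hB : IsArm G c B) (hC : IsArm G c C) (hAB : A.Disjoint B)
    (hAC : A.Disjoint C) (hBC : B.Disjoint C) {v : V} (hv : v ∈ A) :
    G.degree v + 13 ≤ Fintype.card V := by
  have hdisj : Disjoint (G.neighborFinset v) (v :: (B ++ C)).toFinset := by
    rw [Finset.disjoint_left]
    intro z hz hz'
    rw [SimpleGraph.mem_neighborFinset] at hz
    simp only [List.mem_toFinset, List.mem_cons, List.mem_append] at hz'
    rcases hz' with rfl | h | h
    · exact hz.ne rfl
    · exact hno (hasTwoPaths_of_adj_arms hA hB hC hAB hAC hBC hv h hz)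
    · exact hno (hasTwoPaths_of_adj_arms hA hC hB hAC hAB hBC.symm hv h hz)
  have hnd : (v :: (B ++ C)).Nodup := by
    refine List.nodup_cons.2 ⟨fun h => ?_, List.nodup_append'.2 ⟨hB.2.1, hC.2.1, hBC⟩⟩
    rcases List.mem_append.1 h with h | h
    · exact hAB hv h
    · exact hAC hv h
  have := Finset.card_le_univ (G.neighborFinset v ∪ (v :: (B ++ C)).toFinset)
  rw [Finset.card_union_of_disjoint hdisj, List.toFinset_card_of_nodup hnd,
    SimpleGraph.card_neighborFinset_eq_degree] at this
  simpa [hB.2.2.2, hC.2.2.2] using this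

theorem ncard_edgeSet_le_of_arms {G : SimpleGraph V} (hno : ¬ HasTwoPaths G) {c : V}
    {A B C : List V} (hA : IsArm G c A) (hB : IsArm G c B) (hC : IsArm G c C)
    (hAB : A.Disjoint B) (hAC : A.Disjoint C) (hBC : B.Disjoint C) :
    19 ≤ Fintype.card V ∧ 2 * G.edgeSet.ncard ≤ 18 * (Fintype.card V - 13) +
      (Fintype.card V - 18) * (Fintype.card V - 1) := by
  set T := (A ++ (B ++ C)).toFinset with hT
  have hTc : T.card = 18 := by
    rw [hT, List.toFinset_card_of_nodup]
    · simp [hA.2.2.2, hB.2.2.2, hC.2.2.2]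
    · refine List.nodup_append'.2 ⟨hA.2.1, List.nodup_append'.2 ⟨hB.2.1, hC.2.1, hBC⟩, ?_⟩
      intro z hz hz'
      rcases List.mem_append.1 hz' with h | h
      · exact hAB hz h
      · exact hAC hz h
  have hcT : c ∉ T := by
    simp [hT, hA.2.2.1, hB.2.2.1, hC.2.2.1]
  constructor
  · have := Finset.card_le_univ (insert c T)
    rwa [Finset.card_insert_of_notMem hcT, hTc] at this
  · rw [← sum_degree_eq_two_mul_ncard, ← Finset.sum_add_sum_compl T]
    refine add_le_add ?_ ?_
    · refine (Finset.sum_le_card_nsmul T _ (Fintype.card V - 13) fun v hv => ?_).trans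
        (by rw [hTc, smul_eq_mul])
      simp only [hT, List.mem_toFinset, List.mem_append] at hv
      rcases hv with hv | hv | hv
      · have := degree_le_of_mem_arm hno hA hB hC hAB hAC hBC hv
        omega
      · have := degree_le_of_mem_arm hno hB hA hC hAB.symm hBC hAC hv
        omega
      · have := degree_le_of_mem_arm hno hC hA hB hAC.symm hBC.symm hAB hv
        omega
    · refine (Finset.sum_le_card_nsmul Tᶜ _ (Fintype.card V - 1) fun v _ => ?_).trans
        (by rw [Finset.card_compl, hTc, smul_eq_mul])
      have := G.degree_lt_card_verts v
      omega

/-- A dense connected graph without two disjoint paths on seven vertices has a vertex of degree at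
most five whose deletion keeps the graph connected. -/
theorem exists_degree_le_five {G : SimpleGraph V} (hc : CutConnected G) (hno : ¬ HasTwoPaths G)
    (h14 : 14 ≤ Fintype.card V) (h20 : Fintype.card V ≤ 20)
    (he : 5 * Fintype.card V ≤ G.edgeSet.ncard + 7) :
    ∃ x, CutConnected (G.induce ({x}ᶜ : Set V)) ∧ G.degree x ≤ 5 := by
  have : Nonempty V := Fintype.card_pos_iff.1 (by omega)
  obtain ⟨P, hP, hne, hmax⟩ := exists_longest_path G
  have hP13 : P.length ≤ 13 := by
    by_contra h
    exact hno (HasPath.hasTwoPaths ⟨P, hP, by omega⟩)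
  obtain ⟨x, hx, hdeg, harm⟩ := exists_removable hc hP hne hmax (by omega)
  refine ⟨x, hx, ?_⟩
  by_contra! h6
  have h13 : P.length = 13 := by omega
  obtain ⟨X, hX, hch, hnd, hdisj⟩ := harm hno h13 h6
  have hsplit : P = P.take 6 ++ P[6] :: P.drop 7 := by
    rw [← List.drop_eq_getElem_cons, List.take_append_drop]
  have hPc := hP.1
  have hPn := hP.2
  rw [hsplit, List.isChain_split] at hPc
  rw [hsplit, List.nodup_append', List.nodup_cons] at hPn
  have hA : IsArm G P[6] (P.take 6) :=
    ⟨hPc.1, hPn.1, fun h => hPn.2.2 h List.mem_cons_self, by simp [h13]⟩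
  have hB : IsArm G P[6] (P.drop 7).reverse :=
    ⟨by rw [← List.reverse_cons]; exact SimpleGraph.isChain_reverse hPc.2,
      List.nodup_reverse.2 hPn.2.1.2,
      by simpa using hPn.2.1.1, by simp [h13]⟩
  have hC : IsArm G P[6] X := ⟨hch, hnd, fun h => hdisj _ h (by simp), hX⟩
  have hfin := ncard_edgeSet_le_of_arms hno hA hB hC
    (fun z hz hz' => hPn.2.2 hz (List.mem_cons_of_mem _ (List.mem_reverse.1 hz')))
    (fun z hz hz' => hdisj z hz' (List.mem_of_mem_take hz))
    (fun z hz hz' => hdisj z hz' (List.mem_of_mem_drop (List.mem_reverse.1 hz)))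
  obtain ⟨h19, hfin⟩ := hfin
  generalize Fintype.card V = m at *
  interval_cases m <;> omega

end Arms

section ConnectedBounds

open scoped Classical

universe u

variable {V : Type u} [Fintype V]

theorem card_compl_singleton_add_one (x : V) :
    Fintype.card ({x}ᶜ : Set V) + 1 = Fintype.card V := by
  have h := Fintype.card_compl_set ({x} : Set V)
  have h1 : 0 < Fintype.card V := Fintype.card_pos_iff.2 ⟨x⟩
  have h2 : Fintype.card ({x} : Set V) = 1 := by simp
  omega

theorem ncard_edgeSet_le_induce_compl_add_degree (G : SimpleGraph V) (x : V) :
    G.edgeSet.ncard ≤ (G.induce ({x}ᶜ : Set V)).edgeSet.ncard + G.degree x := by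
  have h := ncard_edgeSet_le_induce_add_sum_degree G ({x}ᶜ : Finset V)
  rwa [compl_compl, Finset.sum_singleton, Finset.coe_compl, Finset.coe_singleton] at h

theorem exists_adj_of_cutConnected {G : SimpleGraph V} (hc : CutConnected G)
    (h2 : 2 ≤ Fintype.card V) (v : V) : ∃ w, G.Adj v w := by
  by_contra! h
  rcases hc {v} (by rintro a rfl b hab; exact absurd hab (h b)) with h0 | h0
  · exact Set.singleton_ne_empty v h0
  · have := Fintype.card_le_one_iff.2 (fun a b : V => by
      have ha : a ∈ ({v} : Set V) := h0 ▸ Set.mem_univ a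
      have hb : b ∈ ({v} : Set V) := h0 ▸ Set.mem_univ b
      rw [Set.mem_singleton_iff] at ha hb
      rw [ha, hb])
    omega

theorem ncard_edgeSet_le_of_cutConnected_of_not_hasPath (n : ℕ) :
    ∀ {V : Type u} [Fintype V] {G : SimpleGraph V}, Fintype.card V = n + 7 → CutConnected G →
      ¬ HasPath G 7 → G.edgeSet.ncard ≤ 2 * n + 12 := by
  induction n with
  | zero =>
    intro V _ G hV hc hP
    simpa using ncard_edgeSet_le_twelve (by omega) hP
      (exists_adj_of_cutConnected hc (by omega))
  | succ n ih =>
    intro V _ G hV hc hP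
    have : Nonempty V := Fintype.card_pos_iff.1 (by omega)
    obtain ⟨P, hPl, hne, hmax⟩ := exists_longest_path G
    have hlen : P.length ≤ 6 := by
      by_contra h
      exact hP ⟨P, hPl, by omega⟩
    obtain ⟨x, hx, hdeg, -⟩ := exists_removable hc hPl hne hmax (by omega)
    have h1 := card_compl_singleton_add_one x
    have h2 := ih (by omega) hx (fun h => hP h.of_induce)
    have h3 := ncard_edgeSet_le_induce_compl_add_degree G x
    omega

theorem two_leaves_common_neighbour {G : SimpleGraph V} (hV : Fintype.card V = 14)
    (hP : ¬ HasPath G 14) (he : 66 ≤ G.edgeSet.ncard) {x y p : V} (hxy : x ≠ y)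
    (hx : G.degree x ≤ 2) (hy : G.degree y ≤ 5) (hxp : G.Adj x p) (hpy : p ≠ y)
    (hy0 : ∃ z, G.Adj y z) : (∀ z, G.Adj x z → z = p) ∧ ∀ z, G.Adj y z → z = p := by
  have hdeg : ∀ v, v ≠ x → v ≠ y → 2 ≤ G.degree v := by
    intro v hvx hvy
    by_contra! hv
    have h1 := ncard_edgeSet_le_induce_add_sum_degree G ({x, y, v}ᶜ : Finset V)
    have h2 := ncard_edgeSet_induce_le_choose G ({x, y, v}ᶜ : Finset V)
    have h3 : ({x, y, v} : Finset V).card = 3 := Finset.card_eq_three.2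
      ⟨x, y, v, hxy, hvx.symm, hvy.symm, rfl⟩
    rw [compl_compl, Finset.sum_insert (by simp [hxy, hvx.symm]),
      Finset.sum_insert (by simp [hvy.symm]), Finset.sum_singleton] at h1
    rw [Finset.card_compl, hV, h3] at h2
    norm_num [Nat.choose] at h2
    omega
  have hiso : ∀ v, ∃ w, G.Adj v w := by
    intro v
    by_cases hvx : v = x
    · exact ⟨p, hvx ▸ hxp⟩
    by_cases hvy : v = y
    · exact hvy ▸ hy0
    · rw [← SimpleGraph.degree_pos_iff_exists_adj]
      have := hdeg v hvx hvy
      omega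
  obtain ⟨a, b, r, s, hab, ha, hb, hrs⟩ :=
    exists_two_leaves hV hP (by omega) ⟨y, hy⟩ hiso
  have hleaf : ∀ v w, (∀ z, G.Adj v z ↔ z = w) → v = x ∨ v = y := by
    intro v w hv
    by_contra! h
    have h2 := hdeg v h.1 h.2
    have : G.neighborFinset v = {w} := by
      ext z
      simp [hv]
    rw [← SimpleGraph.card_neighborFinset_eq_degree, this, Finset.card_singleton] at h2
    omega
  rcases hleaf a r ha with rfl | rfl <;> rcases hleaf b s hb with rfl | rfl
  · exact absurd rfl hab
  · obtain rfl := (ha p).1 hxp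
    rcases hrs with rfl | h
    · exact ⟨fun z => (ha z).1, fun z => (hb z).1⟩
    · exact absurd ((ha _).1 h).symm hpy
  · obtain rfl := (hb p).1 hxp
    rcases hrs with rfl | h
    · exact ⟨fun z => (hb z).1, fun z => (ha z).1⟩
    · exact absurd ((hb _).1 h.symm).symm hpy
  · exact absurd rfl hab

/-- All but twelve vertices are pendant vertices with a common neighbour. -/
def HasCommonLeaves (G : SimpleGraph V) : Prop :=
  ∃ (p : V) (L : Finset V), L.card + 12 = Fintype.card V ∧ ∀ w ∈ L, ∀ z, G.Adj w z ↔ z = p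

theorem HasCommonLeaves.ncard_edgeSet_le {G : SimpleGraph V} (h : HasCommonLeaves G) :
    G.edgeSet.ncard ≤ Fintype.card V + 54 := by
  obtain ⟨p, L, hL, hadj⟩ := h
  have h1 := ncard_edgeSet_le_induce_add_sum_degree G Lᶜ
  have h2 := ncard_edgeSet_induce_le_choose G Lᶜ
  have h3 : ∑ w ∈ L, G.degree w ≤ L.card := by
    refine (Finset.sum_le_card_nsmul L _ 1 fun v hv => ?_).trans (by simp)
    have : G.neighborFinset v = {p} := by
      ext z
      simp [hadj v hv]
    rw [← SimpleGraph.card_neighborFinset_eq_degree, this, Finset.card_singleton]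
  have h4 : Lᶜ.card = 12 := by rw [Finset.card_compl]; omega
  rw [compl_compl] at h1
  rw [h4] at h2
  norm_num [Nat.choose] at h2
  omega

theorem hasCommonLeaves_of_card_eq_fourteen {G : SimpleGraph V} (hV : Fintype.card V = 14)
    (hc : CutConnected G) (hno : ¬ HasTwoPaths G) (he : 63 ≤ G.edgeSet.ncard) :
    HasCommonLeaves G := by
  obtain ⟨v, -, hv⟩ := exists_degree_le_five hc hno (by omega) (by omega) (by omega)
  obtain ⟨x, y, p, q, hxy, hx, hy, hpq⟩ := exists_two_leaves hV (fun h => hno h.hasTwoPaths) he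
    ⟨v, hv⟩ (exists_adj_of_cutConnected hc (by omega))
  have hnadj : ¬ G.Adj x y := by
    intro h
    obtain rfl := (hx y).1 h
    obtain rfl := (hy x).1 h.symm
    rcases hc {x, y} (by
      rintro a (rfl | rfl) b hab
      · exact Or.inr ((hx b).1 hab)
      · exact Or.inl ((hy b).1 hab)) with h0 | h0
    · exact (Set.insert_nonempty x {y}).ne_empty h0
    · have h1 : (Finset.univ : Finset V) ⊆ {x, y} := by
        intro z _
        have : z ∈ ({x, y} : Set V) := h0 ▸ Set.mem_univ z
        simpa using this
      have h2 := (Finset.card_le_card h1).trans Finset.card_le_two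
      rw [Finset.card_univ] at h2
      omega
  obtain rfl := hpq.resolve_right hnadj
  refine ⟨p, {x, y}, by rw [Finset.card_pair hxy, hV], ?_⟩
  intro w hw
  rw [Finset.mem_insert, Finset.mem_singleton] at hw
  rcases hw with rfl | rfl
  · exact hx
  · exact hy

theorem adj_iff_of_leaves_of_removed {G : SimpleGraph V} (hno : ¬ HasTwoPaths G)
    (h2 : 15 ≤ Fintype.card V) (he : 5 * Fintype.card V ≤ G.edgeSet.ncard + 7)
    {u p : V} {L : Finset V} (huL : u ∉ L) (hpu : p ≠ u) (hpL : p ∉ L)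
    (hL : L.card + 13 = Fintype.card V) (hadj : ∀ w ∈ L, ∀ z, z ≠ u → (G.Adj w z ↔ z = p))
    (hu : G.degree u ≤ 5) {x : V} (hx : x ∈ L) (huW : ∃ z, G.Adj u z ∧ z ∉ L.erase x) :
    ¬ G.Adj x u ∧ ∀ z, z ∉ L → G.Adj u z → z = p := by
  have hdeg : ∀ w ∈ L, G.degree w ≤ 2 := by
    intro w hw
    have : G.neighborFinset w ⊆ {u, p} := by
      intro z hz
      rw [SimpleGraph.mem_neighborFinset] at hz
      rw [Finset.mem_insert, Finset.mem_singleton]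
      by_cases hzu : z = u
      · exact Or.inl hzu
      · exact Or.inr ((hadj w hw z hzu).1 hz)
    rw [← SimpleGraph.card_neighborFinset_eq_degree]
    exact (Finset.card_le_card this).trans Finset.card_le_two
  obtain ⟨W, hW⟩ : ∃ W : Finset V, W = (L.erase x)ᶜ := ⟨_, rfl⟩
  have hWc : W.card = 14 := by
    rw [hW, Finset.card_compl, Finset.card_erase_of_mem hx]
    have := Finset.card_pos.2 ⟨x, hx⟩
    omega
  have hcardW : Fintype.card (W : Set V) = 14 := by simpa using hWc
  have heW : 66 ≤ (G.induce (W : Set V)).edgeSet.ncard := by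
    have h1 := ncard_edgeSet_le_induce_add_sum_degree G W
    rw [hW, compl_compl, ← hW] at h1
    have h3 := Finset.sum_le_card_nsmul (L.erase x) (fun w => G.degree w) 2
      fun v hv => hdeg v (Finset.mem_of_mem_erase hv)
    rw [Finset.card_erase_of_mem hx, smul_eq_mul] at h3
    omega
  have hWL : ∀ z, z ∉ L → z ∈ (W : Set V) := fun z hz => by simp [hW, hz]
  have hxW : x ∈ (W : Set V) := by simp [hW]
  have hxu : x ≠ u := fun h => huL (h ▸ hx)
  have hdx := (degree_induce_le G W ⟨x, hxW⟩).trans (hdeg x hx)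
  have hdu := (degree_induce_le G W ⟨u, hWL u huL⟩).trans hu
  have huz : ∃ z, (G.induce (W : Set V)).Adj ⟨u, hWL u huL⟩ z := by
    obtain ⟨z, hz, hzL⟩ := huW
    exact ⟨⟨z, by rw [hW, Finset.mem_coe, Finset.mem_compl]; exact hzL⟩, hz⟩
  have hxp : (G.induce (W : Set V)).Adj ⟨x, hxW⟩ ⟨p, hWL p hpL⟩ := (hadj x hx p hpu).2 rfl
  have hP : ¬ HasPath (G.induce (W : Set V)) 14 := fun h => hno h.of_induce.hasTwoPaths
  obtain ⟨h3, h4⟩ := two_leaves_common_neighbour hcardW hP heW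
    (fun h => hxu (Subtype.ext_iff.1 h)) hdx hdu hxp (fun h => hpu (Subtype.ext_iff.1 h)) huz
  constructor
  · intro h
    have := h3 ⟨u, hWL u huL⟩ h
    exact hpu (Subtype.ext_iff.1 this).symm
  · intro z hz hadjz
    have := h4 ⟨z, hWL z hz⟩ hadjz
    exact Subtype.ext_iff.1 this

theorem hasCommonLeaves_of_cutConnected (n : ℕ) (hn : n ≤ 6) :
    ∀ {V : Type u} [Fintype V] {G : SimpleGraph V}, Fintype.card V = n + 14 → CutConnected G →
      ¬ HasTwoPaths G → 5 * Fintype.card V ≤ G.edgeSet.ncard + 7 → HasCommonLeaves G := by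
  induction n with
  | zero =>
    intro V _ G hV hc hno he
    exact hasCommonLeaves_of_card_eq_fourteen (by omega) hc hno (by omega)
  | succ n ih =>
    intro V _ G hV hc hno he
    obtain ⟨u, hcu, hu⟩ := exists_degree_le_five hc hno (by omega) (by omega) he
    have h1 := card_compl_singleton_add_one u
    have h2 := ncard_edgeSet_le_induce_compl_add_degree G u
    obtain ⟨p', L', hL', hadj'⟩ := ih (by omega) (by omega) hcu (fun h => hno h.of_induce)
      (by omega)
    obtain ⟨p, hpu⟩ := p'
    have hpu' : p ≠ u := hpu
    set L : Finset V := L'.map (Function.Embedding.subtype _) with hLdef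
    have hLcard : L.card = L'.card := Finset.card_map _
    have hmemL : ∀ w ∈ L, ∃ h : w ∈ ({u}ᶜ : Set V), (⟨w, h⟩ : ({u}ᶜ : Set V)) ∈ L' := by
      intro w hw
      simpa [hLdef] using hw
    have huL : u ∉ L := fun h => (hmemL u h).1 rfl
    have hadj : ∀ w ∈ L, ∀ z, z ≠ u → (G.Adj w z ↔ z = p) := by
      intro w hw z hz
      obtain ⟨hwu, hwL⟩ := hmemL w hw
      have := hadj' _ hwL ⟨z, hz⟩
      exact this.trans Subtype.ext_iff
    have hpL : p ∉ L := fun h => (G.loopless.irrefl p) ((hadj p h p hpu').2 rfl)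
    have key := fun x hx => adj_iff_of_leaves_of_removed hno (by omega) he huL hpu' hpL
      (by omega) hadj hu (x := x) hx
    obtain ⟨y, hy⟩ := exists_adj_of_cutConnected hc (by omega) u
    have hnadj : ∀ z ∈ L, ¬ G.Adj u z := fun z hz h => (key z hz ⟨z, h, by simp⟩).1 h.symm
    have huadj : ∀ z, G.Adj u z → z = p := by
      intro z hz
      obtain ⟨x, hx⟩ := Finset.card_pos.1 (show 0 < L.card by omega)
      have hzL : z ∉ L := fun h => hnadj z h hz
      exact (key x hx ⟨z, hz, fun h => hzL (Finset.mem_of_mem_erase h)⟩).2 z hzL hz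
    obtain rfl := huadj y hy
    refine ⟨y, insert u L, by rw [Finset.card_insert_of_notMem huL]; omega, ?_⟩
    intro w hw z
    rcases Finset.mem_insert.1 hw with rfl | hw
    · exact ⟨huadj z, fun h => h ▸ hy⟩
    · by_cases hzu : z = u
      · subst hzu
        exact ⟨fun h => absurd h.symm (hnadj w hw), fun h => absurd h.symm hpu'⟩
      · exact hadj w hw z hzu

end ConnectedBounds

section Extremal

open scoped Classical

universe u

/-- The number of edges of disjoint copies of `K₆` together with one smaller clique, on `b`
vertices in total. -/
def pathBound (b : ℕ) : ℕ := 15 * (b / 6) + (b % 6).choose 2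

theorem pathBound_add_le : ∀ a < 22, ∀ b < 22 - a,
    pathBound a + pathBound b ≤ pathBound (a + b) := by
  decide +kernel

theorem two_mul_add_le_pathBound : ∀ n < 15, 2 * n + 12 ≤ pathBound (n + 7) := by
  decide +kernel

theorem choose_two_le_pathBound : ∀ b < 7, b.choose 2 ≤ pathBound b := by
  decide +kernel

theorem choose_two_add_pathBound_le : ∀ a < 14, ∀ b < 22 - a, 14 ≤ a + b →
    a.choose 2 + pathBound b ≤ 78 + pathBound (a + b - 13) ∧
      (a.choose 2 + pathBound b = 78 + pathBound (a + b - 13) → a = 13) := by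
  decide +kernel

theorem lt_pathBound_of_connected : ∀ n < 7, n + 68 < 78 + pathBound (n + 1) ∧
    5 * n + 63 ≤ 78 + pathBound (n + 1) := by
  decide +kernel

variable {V : Type u}

theorem exists_split {G : SimpleGraph V} (h : ¬ CutConnected G) :
    ∃ S : Set V, (∀ a ∈ S, ∀ b, G.Adj a b → b ∈ S) ∧ S.Nonempty ∧ Sᶜ.Nonempty := by
  unfold CutConnected at h
  push Not at h
  obtain ⟨S, hS, hne, hnu⟩ := h
  exact ⟨S, hS, hne, Set.nonempty_compl.2 hnu⟩

/-- In a disconnected graph without two disjoint paths on seven vertices, some part of a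
disconnection contains no path on seven vertices. -/
theorem exists_split_of_not_hasTwoPaths {G : SimpleGraph V} (h : ¬ CutConnected G)
    (hno : ¬ HasTwoPaths G) :
    ∃ S : Set V, (∀ a ∈ S, ∀ b, G.Adj a b → b ∈ S) ∧ S.Nonempty ∧ Sᶜ.Nonempty ∧
      ¬ HasPath (G.induce Sᶜ) 7 := by
  obtain ⟨S, hS, hne, hne'⟩ := exists_split h
  by_cases hP : HasPath (G.induce Sᶜ) 7
  · refine ⟨Sᶜ, fun a ha b hab hb => ha (hS b hb a hab.symm), hne', by rwa [compl_compl], ?_⟩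
    rw [compl_compl]
    exact fun h => hno (hasTwoPaths_of_induce_compl h hP)
  · exact ⟨S, hS, hne, hne', hP⟩

/-- Some thirteen vertices form a clique with no edges to the other vertices. -/
def HasCliqueComponent (G : SimpleGraph V) : Prop :=
  ∃ S : Set V, S.ncard = 13 ∧ (∀ a ∈ S, ∀ b, G.Adj a b → b ∈ S) ∧
    ∀ a ∈ S, ∀ b ∈ S, a ≠ b → G.Adj a b

theorem HasCliqueComponent.of_induce {G : SimpleGraph V} {S : Set V}
    (hS : ∀ a ∈ S, ∀ b, G.Adj a b → b ∈ S) (h : HasCliqueComponent (G.induce S)) :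
    HasCliqueComponent G := by
  obtain ⟨T, hT, hcl, hK⟩ := h
  refine ⟨Subtype.val '' T, ?_, ?_, ?_⟩
  · rw [Set.ncard_image_of_injective _ Subtype.val_injective, hT]
  · rintro _ ⟨a, ha, rfl⟩ b hab
    exact ⟨⟨b, hS a a.2 b hab⟩, hcl a ha ⟨b, hS a a.2 b hab⟩ hab, rfl⟩
  · rintro _ ⟨a, ha, rfl⟩ _ ⟨b, hb, rfl⟩ hab
    exact hK a ha b hb (fun h => hab (h ▸ rfl))

theorem nonempty_iso_completeGraph_sum {G : SimpleGraph V} {S : Set V}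
    (hS : ∀ a ∈ S, ∀ b, G.Adj a b → b ∈ S) (hK : ∀ a ∈ S, ∀ b ∈ S, a ≠ b → G.Adj a b)
    {α β : Type*} (e : S ≃ α) {H : SimpleGraph β} (f : G.induce Sᶜ ≃g H) :
    Nonempty (G ≃g (completeGraph α ⊕g H)) := by
  refine ⟨SimpleGraph.Iso.symm ⟨(Equiv.sumCongr e.symm f.symm.toEquiv).trans
    (Equiv.Set.sumCompl S), ?_⟩⟩
  rintro (a | a) (b | b)
  · constructor
    · intro h
      have : a ≠ b := by
        rintro rfl
        exact h.ne rfl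
      simpa using this
    · intro h
      have hab : a ≠ b := by simpa using h
      exact hK _ (e.symm a).2 _ (e.symm b).2
        (fun h => hab (e.symm.injective (Subtype.ext h)))
  · constructor
    · intro h
      exact absurd (hS _ (e.symm a).2 _ h) (f.symm b).2
    · intro h
      simp at h
  · constructor
    · intro h
      exact absurd (hS _ (e.symm b).2 _ h.symm) (f.symm a).2
    · intro h
      simp at h
  · simpa using f.symm.map_adj_iff (v := a) (w := b)

variable [Fintype V]

theorem card_add_card_compl {S : Set V} (hne : S.Nonempty) (hne' : Sᶜ.Nonempty) :
    0 < Fintype.card S ∧ 0 < Fintype.card (Sᶜ : Set V) ∧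
      Fintype.card S + Fintype.card (Sᶜ : Set V) = Fintype.card V := by
  refine ⟨Fintype.card_pos_iff.2 hne.to_subtype, Fintype.card_pos_iff.2 hne'.to_subtype, ?_⟩
  have h1 := Fintype.card_compl_set S
  have h2 := set_fintype_card_le_univ S
  omega

theorem ncard_edgeSet_le_pathBound (n : ℕ) (hn : n ≤ 21) :
    ∀ {V : Type u} [Fintype V] {G : SimpleGraph V}, Fintype.card V = n → ¬ HasPath G 7 →
      G.edgeSet.ncard ≤ pathBound n := by
  induction n using Nat.strong_induction_on with
  | _ n ih =>
    intro V _ G hV hP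
    by_cases hc : CutConnected G
    · by_cases h7 : n < 7
      · refine (ncard_edgeSet_le_choose G).trans ?_
        rw [hV]
        exact choose_two_le_pathBound n h7
      · have h1 := ncard_edgeSet_le_of_cutConnected_of_not_hasPath (n - 7) (by omega) hc hP
        have h2 := two_mul_add_le_pathBound (n - 7) (by omega)
        rw [Nat.sub_add_cancel (by omega)] at h2
        omega
    · obtain ⟨S, hS, hne, hne'⟩ := exists_split hc
      obtain ⟨h1, h2, h3⟩ := card_add_card_compl hne hne'
      have h4 := ncard_edgeSet_le_induce_add_induce_compl G S hS
      have h5 := ih (Fintype.card S) (by omega) (by omega) rfl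
        (fun h : HasPath (G.induce S) 7 => hP h.of_induce)
      have h6 := ih (Fintype.card (Sᶜ : Set V)) (by omega) (by omega) rfl
        (fun h : HasPath (G.induce Sᶜ) 7 => hP h.of_induce)
      have h7 := pathBound_add_le (Fintype.card S) (by omega) (Fintype.card (Sᶜ : Set V))
        (by omega)
      rw [h3, hV] at h7
      omega

theorem adj_of_ncard_edgeSet_eq_choose {G : SimpleGraph V}
    (h : (Fintype.card V).choose 2 ≤ G.edgeSet.ncard) {a b : V} (hab : a ≠ b) : G.Adj a b := by
  have h1 : G.edgeFinset = (⊤ : SimpleGraph V).edgeFinset := by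
    refine Finset.eq_of_subset_of_card_le (SimpleGraph.edgeFinset_mono le_top) ?_
    rw [SimpleGraph.card_edgeFinset_top_eq_card_choose_two]
    rwa [← SimpleGraph.coe_edgeFinset, Set.ncard_coe_finset] at h
  rw [SimpleGraph.edgeFinset_inj] at h1
  rw [h1]
  exact hab

/-- The bound on the number of edges, with the case of equality. -/
def ExtremalBound (G : SimpleGraph V) : Prop :=
  G.edgeSet.ncard ≤ 78 + pathBound (Fintype.card V - 13) ∧
    (G.edgeSet.ncard = 78 + pathBound (Fintype.card V - 13) → HasCliqueComponent G)

theorem extremalBound_of_closed {G : SimpleGraph V} {S : Set V}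
    (hS : ∀ a ∈ S, ∀ b, G.Adj a b → b ∈ S)
    (hcard : Fintype.card S + Fintype.card (Sᶜ : Set V) = Fintype.card V)
    (h14 : 14 ≤ Fintype.card V) (h21 : Fintype.card V ≤ 21) (hP : ¬ HasPath (G.induce Sᶜ) 7)
    (hih : 14 ≤ Fintype.card S → ExtremalBound (G.induce S)) : ExtremalBound G := by
  have h1 := ncard_edgeSet_le_induce_add_induce_compl G S hS
  have h2 := ncard_edgeSet_le_pathBound _ (by omega) rfl hP
  by_cases ha : Fintype.card S < 14
  · have h3 := ncard_edgeSet_le_choose (G.induce S)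
    obtain ⟨h4, h5⟩ := choose_two_add_pathBound_le (Fintype.card S) ha
      (Fintype.card (Sᶜ : Set V)) (by omega) (by omega)
    rw [hcard] at h4 h5
    refine ⟨by omega, fun heq => ?_⟩
    refine ⟨S, ?_, hS, ?_⟩
    · rw [← h5 (by omega), ← Nat.card_eq_fintype_card, Nat.card_coe_set_eq]
    · intro a ha b hb hab
      exact adj_of_ncard_edgeSet_eq_choose (G := G.induce S) (a := ⟨a, ha⟩) (b := ⟨b, hb⟩)
        (by omega) (fun h => hab (Subtype.ext_iff.1 h))
  · obtain ⟨h3, h4⟩ := hih (by omega)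
    have h5 := pathBound_add_le (Fintype.card S - 13) (by omega) (Fintype.card (Sᶜ : Set V))
      (by omega)
    rw [show Fintype.card S - 13 + Fintype.card (Sᶜ : Set V) = Fintype.card V - 13 by omega] at h5
    exact ⟨by omega, fun heq => (h4 (by omega)).of_induce hS⟩

theorem extremalBound_of_not_hasTwoPaths (n : ℕ) (h14 : 14 ≤ n) (h21 : n ≤ 21) :
    ∀ {V : Type u} [Fintype V] {G : SimpleGraph V}, Fintype.card V = n → ¬ HasTwoPaths G →
      (CutConnected G → n ≤ 20) → ExtremalBound G := by
  induction n using Nat.strong_induction_on with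
  | _ n ih =>
    intro V _ G hV hno h20
    by_cases hc : CutConnected G
    · have h1 := h20 hc
      suffices h : G.edgeSet.ncard < 78 + pathBound (Fintype.card V - 13) from
        ⟨h.le, fun heq => absurd heq h.ne⟩
      obtain ⟨h2, h3⟩ := lt_pathBound_of_connected (n - 14) (by omega)
      rw [show n - 14 + 1 = Fintype.card V - 13 by omega] at h2 h3
      by_contra! h
      have := (hasCommonLeaves_of_cutConnected (n - 14) (by omega) (by omega) hc hno
        (by omega)).ncard_edgeSet_le
      omega
    · obtain ⟨S, hS, hne, hne', hP⟩ := exists_split_of_not_hasTwoPaths hc hno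
      obtain ⟨h1, h2, h3⟩ := card_add_card_compl hne hne'
      refine extremalBound_of_closed hS h3 (by omega) (by omega) hP fun h => ?_
      exact ih _ (by omega) h (by omega) rfl (fun h => hno h.of_induce) (fun _ => by omega)

theorem hasPath_induce_of_clique {G : SimpleGraph V} {S : Set V} (hS : S.ncard = 13)
    (hK : ∀ a ∈ S, ∀ b ∈ S, a ≠ b → G.Adj a b) : HasPath (G.induce S) 7 := by
  refine ⟨(Finset.univ : Finset S).toList, ⟨?_, Finset.nodup_toList _⟩, ?_⟩
  · refine List.Pairwise.isChain ?_
    refine List.Pairwise.imp (fun {a b} (hab : a ≠ b) => ?_) (Finset.nodup_toList _)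
    exact hK a.1 a.2 b.1 b.2 (fun h => hab (Subtype.ext h))
  · rw [Finset.length_toList, Finset.card_univ, ← Nat.card_eq_fintype_card,
      Nat.card_coe_set_eq, hS]
    norm_num

end Extremal

/-- If `G` is a disconnected `2P₇`-free graph on `n` vertices, `14 ≤ n ≤ 21`,
with exactly `[n,14,7]` edges, then `G ≅ K₁₃ ∪ H` where `H` is a `P₇`-free graph
on `n - 13` vertices with the maximum possible number of edges. -/
theorem stmt19 (n : ℕ) (hn₁ : 14 ≤ n) (hn₂ : n ≤ 21) (G : SimpleGraph (Fin n))
    (hfree : ¬ Contains TwoP7 G) (hcard : G.edgeSet.ncard = bracket n 14 7)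
    (hdisc : ¬ G.Connected) :
    ∃ H : SimpleGraph (Fin (n - 13)),
      ¬ Contains (SimpleGraph.pathGraph 7) H ∧
      (∀ H' : SimpleGraph (Fin (n - 13)),
        ¬ Contains (SimpleGraph.pathGraph 7) H' → H'.edgeSet.ncard ≤ H.edgeSet.ncard) ∧
      Nonempty (G ≃g (completeGraph (Fin 13) ⊕g H)) := by
  classical
  have hno : ¬ HasTwoPaths G := fun h => hfree h.contains
  have : Nonempty (Fin n) := ⟨⟨0, by omega⟩⟩
  have hcut := exists_closed_of_not_connected hdisc
  have hbr : bracket n 14 7 = 78 + pathBound (Fintype.card (Fin n) - 13) := by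
    rw [Fintype.card_fin]
    interval_cases n <;> decide
  obtain ⟨S, hS, hcl, hK⟩ := (extremalBound_of_not_hasTwoPaths n hn₁ hn₂ (Fintype.card_fin n) hno
    (fun h => absurd h hcut)).2 (hcard.trans hbr)
  have hScard : Fintype.card S = 13 := by
    rw [← Nat.card_eq_fintype_card, Nat.card_coe_set_eq, hS]
  have hSccard : Fintype.card (Sᶜ : Set (Fin n)) = n - 13 := by
    rw [Fintype.card_compl_set, hScard, Fintype.card_fin]
  have e₁ : S ≃ Fin 13 := Fintype.equivFinOfCardEq hScard
  have e₂ : (Sᶜ : Set (Fin n)) ≃ Fin (n - 13) := Fintype.equivFinOfCardEq hSccard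
  let φ : G.induce Sᶜ ≃g (G.induce Sᶜ).comap e₂.symm :=
    (SimpleGraph.Iso.comap e₂.symm (G.induce Sᶜ)).symm
  have hPc : ¬ HasPath (G.induce Sᶜ) 7 := fun h =>
    hno (hasTwoPaths_of_induce_compl (hasPath_induce_of_clique hS hK) h)
  refine ⟨(G.induce Sᶜ).comap e₂.symm, ?_, fun H' hH' => ?_,
    nonempty_iso_completeGraph_sum hcl hK e₁ φ⟩
  · rintro ⟨f, hf⟩
    exact hPc (Contains.hasPath ⟨φ.symm.toHom.comp f, φ.symm.injective.comp hf⟩)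
  · have h1 : H'.edgeSet.ncard ≤ pathBound (n - 13) :=
      ncard_edgeSet_le_pathBound (n - 13) (by omega) (Fintype.card_fin _) fun h => hH' h.contains
    have h2 := ncard_edgeSet_le_induce_add_induce_compl G S hcl
    have h3 := ncard_edgeSet_le_choose (G.induce S)
    have h4 : (G.induce Sᶜ).edgeSet.ncard = ((G.induce Sᶜ).comap e₂.symm).edgeSet.ncard := by
      rw [← Nat.card_coe_set_eq, ← Nat.card_coe_set_eq]
      exact Nat.card_congr φ.mapEdgeSet
    rw [hScard, show Nat.choose 13 2 = 78 by decide] at h3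
    rw [Fintype.card_fin] at hbr
    omega
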